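/- arXiv:2309.11864 — 14 statements merged into one kernel-verified Lean document; each statement's English description precedes it below -/
import Mathlib

section
/- Let P be a type II multiple orthogonal polynomial with multi-index (n,n) for (μ₁,μ₂) (n ≥ 1), and suppose P has 2n distinct real zeros x_1,…,x_{2n} with P′(x_k) ≠ 0 for every k. Then for j = 1,2 the interpolatory quadrature rule with these nodes and weights is exact for all polynomials of degree at most 3n−1: for every real polynomial f with deg f ≤ 3n−1, ∫ f(x) dμ_j(x) = Σ_{k=1}^{2n} λ_k^{(j)} f(x_k). -/
open MeasureTheory Polynomial

/-- The Lagrange interpolation formula at `N` zeros of a monic polynomial `P` of degree `N`. -/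
theorem Polynomial.eq_sum_divByMonic_of_degree_lt {N : ℕ} {P : ℝ[X]} (hmonic : P.Monic)
    (hdeg : P.natDegree = N) {x : Fin N → ℝ} (hinj : Function.Injective x)
    (hroot : ∀ k, P.eval (x k) = 0) (hsimple : ∀ k, (derivative P).eval (x k) ≠ 0)
    {r : ℝ[X]} (hr : r.degree < N) :
    r = ∑ k, C (r.eval (x k) / (derivative P).eval (x k)) * (P /ₘ (X - C (x k))) := by
  have hfactor (k : Fin N) : (X - C (x k)) * (P /ₘ (X - C (x k))) = P :=
    mul_divByMonic_eq_iff_isRoot.2 (hroot k)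
  have hself (k : Fin N) : (P /ₘ (X - C (x k))).eval (x k) = (derivative P).eval (x k) := by
    have h := congrArg (fun p => (derivative p).eval (x k)) (hfactor k)
    simpa [derivative_mul] using h
  have hother {k j : Fin N} (hjk : k ≠ j) : (P /ₘ (X - C (x k))).eval (x j) = 0 := by
    have h := congrArg (fun p => p.eval (x j)) (hfactor k)
    simp only [eval_mul, eval_sub, eval_X, eval_C, hroot j, mul_eq_zero, sub_eq_zero] at h
    exact h.resolve_left fun h => hjk (hinj h).symm
  have hPdeg : P.degree = N := by rw [degree_eq_natDegree hmonic.ne_zero, hdeg]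
  have hcard : (Finset.univ : Finset (Fin N)).card = N := by simp
  refine eq_of_degrees_lt_of_eval_index_eq Finset.univ (v := x) hinj.injOn
    (by rwa [hcard]) ?_ ?_
  · rw [hcard]
    refine (degree_sum_le _ _).trans_lt
      ((Finset.sup_lt_iff (WithBot.bot_lt_coe N)).2 fun k _ => ?_)
    rw [← smul_eq_C_mul]
    refine (degree_smul_le _ _).trans_lt ?_
    exact (degree_divByMonic_lt _ _ hmonic.ne_zero (by simp)).trans_eq hPdeg
  · intro j _
    rw [eval_finsetSum, Finset.sum_eq_single j]
    · rw [eval_mul, eval_C, hself, div_mul_cancel₀ _ (hsimple j)]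
    · intro k _ hkj
      rw [eval_mul, hother hkj, mul_zero]
    · simp

/-- A polynomial orthogonal to `1, x, …, x ^ (m - 1)` is orthogonal to every polynomial of
degree less than `m`. -/
theorem integral_eval_mul_eq_zero_of_degree_lt {μ : Measure ℝ}
    (hint : ∀ p : ℝ[X], Integrable (fun x => p.eval x) μ) {m : ℕ} {P : ℝ[X]}
    (horth : ∀ k < m, ∫ x, P.eval x * x ^ k ∂μ = 0) {q : ℝ[X]} (hq : q.degree < m) :
    ∫ x, (P * q).eval x ∂μ = 0 := by
  have hcongr (x : ℝ) :
      (P * q).eval x = ∑ k ∈ Finset.range m, q.coeff k * (P.eval x * x ^ k) := by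
    rw [eval_mul, eval_eq_sum (p := q), sum_def, Finset.mul_sum]
    refine Finset.sum_subset_zero_on_sdiff (fun k hk => ?_) (fun k hk => ?_) fun k _ => by ring
    · rw [Finset.mem_range, ← Nat.cast_lt (α := WithBot ℕ)]
      exact (le_degree_of_mem_supp k hk).trans_lt hq
    · rw [notMem_support_iff.1 (Finset.mem_sdiff.1 hk).2, zero_mul]
  have hint' (k : ℕ) : Integrable (fun x => P.eval x * x ^ k) μ :=
    (hint (P * X ^ k)).congr (.of_forall fun x => by simp)
  simp_rw [hcongr]
  rw [integral_finsetSum _ fun k _ => (hint' k).const_mul _]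
  refine Finset.sum_eq_zero fun k hk => ?_
  rw [integral_const_mul, horth k (Finset.mem_range.1 hk), mul_zero]

/-- An interpolatory quadrature rule whose `N` nodes are the simple zeros of a polynomial `P`
orthogonal to all polynomials of degree less than `m` is exact in degree less than `N + m`. -/
theorem integral_eval_eq_sum_of_orthogonal {μ : Measure ℝ}
    (hint : ∀ p : ℝ[X], Integrable (fun x => p.eval x) μ) {N m : ℕ} {P : ℝ[X]}
    (hmonic : P.Monic) (hdeg : P.natDegree = N)
    (horth : ∀ k < m, ∫ x, P.eval x * x ^ k ∂μ = 0)
    {x : Fin N → ℝ} (hinj : Function.Injective x) (hroot : ∀ k, P.eval (x k) = 0)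
    (hsimple : ∀ k, (derivative P).eval (x k) ≠ 0) {w : Fin N → ℝ}
    (hw : ∀ k, w k =
      (∫ t, (P /ₘ (X - C (x k))).eval t ∂μ) / (derivative P).eval (x k))
    {f : ℝ[X]} (hf : f.degree < (N + m : ℕ)) :
    ∫ t, f.eval t ∂μ = ∑ k, w k * f.eval (x k) := by
  have hPdeg : P.degree = N := by rw [degree_eq_natDegree hmonic.ne_zero, hdeg]
  have hquot : (f /ₘ P).degree < m := by
    rcases lt_or_ge f.degree P.degree with h | h
    · rw [(divByMonic_eq_zero_iff hmonic).2 h, degree_zero]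
      exact WithBot.bot_lt_coe m
    · rw [← degree_add_divByMonic hmonic h, hPdeg, Nat.cast_add] at hf
      exact lt_of_add_lt_add_left hf
  have hrem : (f %ₘ P).degree < N := hPdeg ▸ degree_modByMonic_lt f hmonic
  have heval (k : Fin N) : (f %ₘ P).eval (x k) = f.eval (x k) := by
    conv_rhs => rw [← modByMonic_add_div f P]
    simp [hroot k]
  have hlagrange := eq_sum_divByMonic_of_degree_lt hmonic hdeg hinj hroot hsimple hrem
  calc
    ∫ t, f.eval t ∂μ = ∫ t, (f %ₘ P).eval t + (P * (f /ₘ P)).eval t ∂μ := by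
      simp_rw [← eval_add, modByMonic_add_div]
    _ = ∫ t, (f %ₘ P).eval t ∂μ := by
      rw [integral_add (hint _) (hint _),
        integral_eval_mul_eq_zero_of_degree_lt hint horth hquot, add_zero]
    _ = ∑ k, w k * f.eval (x k) := by
      rw [hlagrange]
      simp_rw [eval_finsetSum, eval_mul, eval_C]
      rw [integral_finsetSum _ fun k _ => (hint _).const_mul _]
      refine Finset.sum_congr rfl fun k _ => ?_
      rw [integral_const_mul, heval, hw]
      ring

/-- Borges' theorem for the diagonal multi-index `(n,n)`: the interpolatory quadrature rule
whose nodes are the `2n` simple zeros of the type II multiple orthogonal polynomial for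
`(μ₁, μ₂)` is exact for both measures on all polynomials of degree at most `3n - 1`. -/
theorem simultaneous_quadrature_diagonal_exactness
    (μ₁ μ₂ : Measure ℝ)
    (hint₁ : ∀ p : Polynomial ℝ, Integrable (fun x => p.eval x) μ₁)
    (hint₂ : ∀ p : Polynomial ℝ, Integrable (fun x => p.eval x) μ₂)
    (n : ℕ) (hn : 1 ≤ n)
    (P : Polynomial ℝ) (hmonic : P.Monic) (hdeg : P.natDegree = 2 * n)
    (horth₁ : ∀ k < n, ∫ x, P.eval x * x ^ k ∂μ₁ = 0)
    (horth₂ : ∀ k < n, ∫ x, P.eval x * x ^ k ∂μ₂ = 0)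
    (xk : Fin (2 * n) → ℝ) (hinj : Function.Injective xk)
    (hroot : ∀ k, P.eval (xk k) = 0)
    (hsimple : ∀ k, (Polynomial.derivative P).eval (xk k) ≠ 0)
    (lam₁ lam₂ : Fin (2 * n) → ℝ)
    (hlam₁ : ∀ k, lam₁ k =
      (∫ x, (P /ₘ (X - C (xk k))).eval x ∂μ₁) / (Polynomial.derivative P).eval (xk k))
    (hlam₂ : ∀ k, lam₂ k =
      (∫ x, (P /ₘ (X - C (xk k))).eval x ∂μ₂) / (Polynomial.derivative P).eval (xk k)) :
    (∀ f : Polynomial ℝ, f.degree < (3 * n : ℕ) →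
      ∫ x, f.eval x ∂μ₁ = ∑ k, lam₁ k * f.eval (xk k)) ∧
    (∀ f : Polynomial ℝ, f.degree < (3 * n : ℕ) →
      ∫ x, f.eval x ∂μ₂ = ∑ k, lam₂ k * f.eval (xk k)) := by
  have hsum : 3 * n = 2 * n + n := by ring
  rw [hsum]
  exact ⟨fun f hf => integral_eval_eq_sum_of_orthogonal hint₁ hmonic hdeg horth₁ hinj hroot
      hsimple hlam₁ hf,
    fun f hf => integral_eval_eq_sum_of_orthogonal hint₂ hmonic hdeg horth₂ hinj hroot
      hsimple hlam₂ hf⟩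
end

section
/- Let P be a type II multiple orthogonal polynomial with multi-index (n,m) for (μ₁,μ₂), and suppose P has n+m distinct real zeros x_1,…,x_{n+m} with P′(x_k) ≠ 0 for every k. Then the interpolatory quadrature rule with these nodes satisfies: (i) ∫ f(x) dμ₁(x) = Σ_{k=1}^{n+m} λ_k^{(1)} f(x_k) for every real polynomial f with deg f ≤ 2n+m−1, and (ii) ∫ f(x) dμ₂(x) = Σ_{k=1}^{n+m} λ_k^{(2)} f(x_k) for every real polynomial f with deg f ≤ n+2m−1. -/
open MeasureTheory Polynomial

/-- A polynomial all of whose values against the monomials of degree `< n` integrate to zero is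
orthogonal to every polynomial of degree `< n`. -/
theorem integral_eval_mul_eval_eq_zero (μ : Measure ℝ)
    (hint : ∀ p : ℝ[X], Integrable (fun x => p.eval x) μ) {n : ℕ} {P : ℝ[X]}
    (horth : ∀ k < n, ∫ x, P.eval x * x ^ k ∂μ = 0) {q : ℝ[X]} (hq : q.degree < n) :
    ∫ x, P.eval x * q.eval x ∂μ = 0 := by
  have hsum : ∀ x, P.eval x * q.eval x =
      ∑ k ∈ Finset.range n, q.coeff k * (P.eval x * x ^ k) := by
    intro x
    by_cases hq0 : q = 0
    · simp [hq0]
    · rw [eval_eq_sum_range' ((natDegree_lt_iff_degree_lt hq0).2 hq), Finset.mul_sum]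
      exact Finset.sum_congr rfl fun k _ => by ring
  simp_rw [hsum]
  rw [integral_finsetSum]
  · refine Finset.sum_eq_zero fun k hk => ?_
    rw [integral_const_mul, horth k (Finset.mem_range.1 hk), mul_zero]
  · intro k _
    have h : Integrable (fun x => P.eval x * x ^ k) μ := by
      have h := hint (P * X ^ k)
      simp_rw [eval_mul, eval_pow, eval_X] at h
      exact h
    exact h.const_mul (q.coeff k)

/-- Dividing `P` by the linear factor of a root `a` leaves the derivative of `P` as value at `a`. -/
theorem eval_divByMonic_X_sub_C_self {P : ℝ[X]} {a : ℝ} (ha : P.eval a = 0) :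
    (P /ₘ (X - C a)).eval a = (derivative P).eval a := by
  have h := congrArg (fun p => (derivative p).eval a) (mul_divByMonic_eq_iff_isRoot.2 ha)
  simpa [derivative_mul] using h

/-- Dividing `P` by the linear factor of a root `a` keeps every other root. -/
theorem eval_divByMonic_X_sub_C_of_ne {P : ℝ[X]} {a b : ℝ} (ha : P.eval a = 0)
    (hb : P.eval b = 0) (hab : b ≠ a) : (P /ₘ (X - C a)).eval b = 0 := by
  have h := congrArg (eval b) (mul_divByMonic_eq_iff_isRoot.2 ha)
  rw [hb, eval_mul] at h
  exact (mul_eq_zero.1 h).resolve_left (by simpa [sub_eq_zero] using hab)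

/-- Lagrange interpolation at the simple roots of `P`. -/
theorem eq_sum_divByMonic_X_sub_C {N : ℕ} {P : ℝ[X]} (hdeg : P.natDegree = N)
    (xk : Fin N → ℝ) (hinj : Function.Injective xk) (hroot : ∀ k, P.eval (xk k) = 0)
    (hsimple : ∀ k, (derivative P).eval (xk k) ≠ 0) {r : ℝ[X]} (hr : r.degree < N) :
    r = ∑ k, C (r.eval (xk k) / (derivative P).eval (xk k)) * (P /ₘ (X - C (xk k))) := by
  have hlt : (∑ k, C (r.eval (xk k) / (derivative P).eval (xk k)) *
      (P /ₘ (X - C (xk k)))).degree < N := by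
    rw [← mem_degreeLT]
    refine Submodule.sum_mem _ fun k _ => ?_
    rw [← smul_eq_C_mul]
    refine Submodule.smul_mem _ _ (mem_degreeLT.2 ?_)
    have hP : P ≠ 0 := fun h => hsimple k (by simp [h])
    rw [← hdeg, ← degree_eq_natDegree hP]
    exact degree_divByMonic_lt _ _ hP (by simp)
  refine eq_of_degrees_lt_of_eval_index_eq Finset.univ (hinj.injOn) (by simpa using hr)
    (by simpa using hlt) fun j _ => ?_
  rw [eval_finsetSum, Finset.sum_eq_single j]
  · rw [eval_mul, eval_C, eval_divByMonic_X_sub_C_self (hroot j), div_mul_cancel₀ _ (hsimple j)]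
  · intro k _ hk
    rw [eval_mul, eval_divByMonic_X_sub_C_of_ne (hroot k) (hroot j) (hinj.ne hk.symm), mul_zero]
  · simp

/-- The interpolatory quadrature rule at the simple roots of a monic `P` of degree `N` that is
orthogonal to all polynomials of degree `< n` is exact in degree `< n + N`. -/
theorem integral_eval_eq_sum_interpolatory (μ : Measure ℝ)
    (hint : ∀ p : ℝ[X], Integrable (fun x => p.eval x) μ) {n N : ℕ} {P : ℝ[X]}
    (hmonic : P.Monic) (hdeg : P.natDegree = N)
    (horth : ∀ k < n, ∫ x, P.eval x * x ^ k ∂μ = 0)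
    (xk : Fin N → ℝ) (hinj : Function.Injective xk) (hroot : ∀ k, P.eval (xk k) = 0)
    (hsimple : ∀ k, (derivative P).eval (xk k) ≠ 0) (lam : Fin N → ℝ)
    (hlam : ∀ k, lam k =
      (∫ x, (P /ₘ (X - C (xk k))).eval x ∂μ) / (derivative P).eval (xk k))
    {f : ℝ[X]} (hf : f.degree < (n + N : ℕ)) :
    ∫ x, f.eval x ∂μ = ∑ k, lam k * f.eval (xk k) := by
  have hfPr : f %ₘ P + P * (f /ₘ P) = f := modByMonic_add_div f P
  have hr : (f %ₘ P).degree < N := by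
    rw [← hdeg, ← degree_eq_natDegree hmonic.ne_zero]
    exact degree_modByMonic_lt f hmonic
  have hq : (f /ₘ P).degree < n := by
    by_cases hq0 : f /ₘ P = 0
    · simp [hq0]
    · have hf0 : f ≠ 0 := fun h => hq0 (by simp [h])
      have h1 := (natDegree_lt_iff_degree_lt hf0).2 hf
      have h2 : N ≤ f.natDegree := by
        by_contra h
        refine hq0 ((divByMonic_eq_zero_iff hmonic).2 (degree_lt_degree ?_))
        omega
      rw [← natDegree_lt_iff_degree_lt hq0, natDegree_divByMonic f hmonic]
      omega
  have hval : ∀ k, (f %ₘ P).eval (xk k) = f.eval (xk k) := fun k => by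
    conv_rhs => rw [← hfPr]
    simp [hroot k]
  have hlag := eq_sum_divByMonic_X_sub_C hdeg xk hinj hroot hsimple hr
  calc ∫ x, f.eval x ∂μ
      = ∫ x, ((f %ₘ P).eval x + P.eval x * (f /ₘ P).eval x) ∂μ := by
        simp_rw [← eval_mul, ← eval_add, hfPr]
    _ = ∫ x, (f %ₘ P).eval x ∂μ := by
        rw [integral_add (hint _) (by simpa using hint (P * (f /ₘ P))),
          integral_eval_mul_eval_eq_zero μ hint horth hq, add_zero]
    _ = ∫ x, ∑ k, f.eval (xk k) / (derivative P).eval (xk k) *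
          (P /ₘ (X - C (xk k))).eval x ∂μ := by
        rw [hlag]
        simp_rw [eval_finsetSum, eval_mul, eval_C, hval]
    _ = ∑ k, lam k * f.eval (xk k) := by
        rw [integral_finsetSum _ fun k _ => (hint _).const_mul _]
        refine Finset.sum_congr rfl fun k _ => ?_
        rw [integral_const_mul, hlam k]
        ring

/-- Simultaneous Gaussian quadrature for a general multi-index `(n,m)`: with nodes at the
`n+m` simple zeros of the type II multiple orthogonal polynomial `P_{n,m}` for `(μ₁, μ₂)`,
the interpolatory quadrature rule is exact for `μ₁` on polynomials of degree `≤ 2n+m-1`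
and exact for `μ₂` on polynomials of degree `≤ n+2m-1`. -/
theorem simultaneous_quadrature_general_multiindex_exactness
    (μ₁ μ₂ : Measure ℝ)
    (hint₁ : ∀ p : Polynomial ℝ, Integrable (fun x => p.eval x) μ₁)
    (hint₂ : ∀ p : Polynomial ℝ, Integrable (fun x => p.eval x) μ₂)
    (n m : ℕ)
    (P : Polynomial ℝ) (hmonic : P.Monic) (hdeg : P.natDegree = n + m)
    (horth₁ : ∀ k < n, ∫ x, P.eval x * x ^ k ∂μ₁ = 0)
    (horth₂ : ∀ k < m, ∫ x, P.eval x * x ^ k ∂μ₂ = 0)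
    (xk : Fin (n + m) → ℝ) (hinj : Function.Injective xk)
    (hroot : ∀ k, P.eval (xk k) = 0)
    (hsimple : ∀ k, (Polynomial.derivative P).eval (xk k) ≠ 0)
    (lam₁ lam₂ : Fin (n + m) → ℝ)
    (hlam₁ : ∀ k, lam₁ k =
      (∫ x, (P /ₘ (X - C (xk k))).eval x ∂μ₁) / (Polynomial.derivative P).eval (xk k))
    (hlam₂ : ∀ k, lam₂ k =
      (∫ x, (P /ₘ (X - C (xk k))).eval x ∂μ₂) / (Polynomial.derivative P).eval (xk k)) :
    (∀ f : Polynomial ℝ, f.degree < (2 * n + m : ℕ) →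
      ∫ x, f.eval x ∂μ₁ = ∑ k, lam₁ k * f.eval (xk k)) ∧
    (∀ f : Polynomial ℝ, f.degree < (n + 2 * m : ℕ) →
      ∫ x, f.eval x ∂μ₂ = ∑ k, lam₂ k * f.eval (xk k)) := by
  exact ⟨fun f hf => integral_eval_eq_sum_interpolatory μ₁ hint₁ hmonic hdeg horth₁ xk hinj hroot
      hsimple lam₁ hlam₁ (hf.trans_eq (by congr 1; omega)),
    fun f hf => integral_eval_eq_sum_interpolatory μ₂ hint₂ hmonic hdeg horth₂ xk hinj hroot
      hsimple lam₂ hlam₂ (hf.trans_eq (by congr 1; omega))⟩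
end

section
/- Let (P_{n,m})_{n,m≥0} be a doubly indexed family of monic real polynomials with deg P_{n,m} = n+m, P_{0,0} = 1, and conventions P_{−1,m} = P_{n,−1} = 0, satisfying for all n,m ≥ 0 the two nearest neighbor recurrence relations x·P_{n,m}(x) = P_{n+1,m}(x) + c_{n,m}·P_{n,m}(x) + a_{n,m}·P_{n−1,m}(x) + b_{n,m}·P_{n,m−1}(x) and x·P_{n,m}(x) = P_{n,m+1}(x) + d_{n,m}·P_{n,m}(x) + a_{n,m}·P_{n−1,m}(x) + b_{n,m}·P_{n,m−1}(x), with real coefficients a_{n,m}, b_{n,m}, c_{n,m}, d_{n,m} (and a_{0,m} = b_{n,0} = 0). Define the stepline polynomials P_{2k} = P_{k,k}, P_{2k+1} = P_{k+1,k}, and the stepline coefficients β_{2k} = c_{k,k}, β_{2k+1} = d_{k+1,k}, γ_{2k} = a_{k,k} + b_{k,k}, γ_{2k+1} = a_{k+1,k} + b_{k+1,k}, δ_{2k} = a_{k,k}·(c_{k−1,k−1} − d_{k−1,k−1}), δ_{2k+1} = b_{k+1,k}·(d_{k,k−1} − c_{k,k−1}). Then the stepline polynomials satisfy the four-term recurrence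 x·P_N(x) = P_{N+1}(x) + β_N·P_N(x) + γ_N·P_{N−1}(x) + δ_N·P_{N−2}(x) for all N ≥ 0 (with P_{−1} = P_{−2} = 0 and γ_0 = δ_0 = δ_1 = 0). -/
open Polynomial

/-- From the two nearest-neighbor recurrence relations for a doubly indexed family of monic
type II multiple orthogonal polynomials `P_{n,m}`, the stepline polynomials
`P_{2k} = P_{k,k}`, `P_{2k+1} = P_{k+1,k}` satisfy the four-term recurrence
`x·P_N = P_{N+1} + β_N·P_N + γ_N·P_{N-1} + δ_N·P_{N-2}`. -/
theorem stepline_four_term_recurrence_typeII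
    (a b c d : ℕ → ℕ → ℝ)
    (ha0 : ∀ m, a 0 m = 0) (hb0 : ∀ n, b n 0 = 0)
    (P : ℕ → ℕ → Polynomial ℝ)
    (hmonic : ∀ n m, (P n m).Monic) (hdeg : ∀ n m, (P n m).natDegree = n + m)
    (hP00 : P 0 0 = 1)
    (hrec1 : ∀ n m, X * P n m =
      P (n + 1) m + C (c n m) * P n m + C (a n m) * P (n - 1) m + C (b n m) * P n (m - 1))
    (hrec2 : ∀ n m, X * P n m =
      P n (m + 1) + C (d n m) * P n m + C (a n m) * P (n - 1) m + C (b n m) * P n (m - 1))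
    (Ps : ℕ → Polynomial ℝ)
    (hPse : ∀ k, Ps (2 * k) = P k k) (hPso : ∀ k, Ps (2 * k + 1) = P (k + 1) k)
    (β γ δ : ℕ → ℝ)
    (hβe : ∀ k, β (2 * k) = c k k) (hβo : ∀ k, β (2 * k + 1) = d (k + 1) k)
    (hγe : ∀ k, γ (2 * k) = a k k + b k k)
    (hγo : ∀ k, γ (2 * k + 1) = a (k + 1) k + b (k + 1) k)
    (hδ0 : δ 0 = 0) (hδ1 : δ 1 = 0)
    (hδe : ∀ k, δ (2 * (k + 1)) = a (k + 1) (k + 1) * (c k k - d k k))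
    (hδo : ∀ k, δ (2 * (k + 1) + 1) = b (k + 2) (k + 1) * (d (k + 1) k - c (k + 1) k)) :
    ∀ N : ℕ, X * Ps N =
      Ps (N + 1) + C (β N) * Ps N + C (γ N) * Ps (N - 1) + C (δ N) * Ps (N - 2) := by
  intro N
  have hswap : ∀ n m, P (n + 1) m + C (c n m) * P n m = P n (m + 1) + C (d n m) * P n m :=
    fun n m ↦ by linear_combination hrec2 n m - hrec1 n m
  obtain ⟨k, rfl | rfl⟩ := N.even_or_odd'
  · obtain _ | k := k
    · have h := hrec1 0 0
      have h0 := hPse 0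
      have h1 := hPso 0
      have hβ := hβe 0
      have hγ := hγe 0
      simp only [mul_zero, zero_add, ha0, hb0, add_zero, map_zero, zero_mul] at h h0 h1 hβ hγ ⊢
      rw [h0, h1, hβ, hγ, hδ0]
      simpa using h
    · have h := hrec1 (k + 1) (k + 1)
      rw [show 2 * (k + 1) - 1 = 2 * k + 1 by lia, show 2 * (k + 1) - 2 = 2 * k by lia,
        hPse, hPse, hPso, hPso, hβe, hγe, hδe]
      simp only [Nat.add_sub_cancel, C_add, C_sub, C_mul] at h ⊢
      linear_combination h - C (a (k + 1) (k + 1)) * hswap k k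
  · obtain _ | k := k
    · have h := hrec2 1 0
      have h0 := hPse 0
      have h1 := hPso 0
      have h2 := hPse 1
      have hβ := hβo 0
      have hγ := hγo 0
      simp only [mul_zero, zero_add, hb0, add_zero, mul_one] at h h0 h1 h2 hβ hγ ⊢
      rw [h1, h2, hβ, hγ, hδ1, Nat.sub_self, h0]
      simpa using h
    · have h := hrec2 (k + 2) (k + 1)
      rw [show 2 * (k + 1) + 1 + 1 = 2 * (k + 2) by lia,
        show 2 * (k + 1) + 1 - 1 = 2 * (k + 1) by lia,
        show 2 * (k + 1) + 1 - 2 = 2 * k + 1 by lia,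
        hPse, hPse, hPso, hPso, hβo, hγo, hδo]
      simp only [Nat.add_sub_cancel, show k + 2 - 1 = k + 1 by lia, C_add, C_sub, C_mul] at h ⊢
      linear_combination h + C (b (k + 2) (k + 1)) * hswap (k + 1) k
end

section
/- Let (b_n), (c_n), (d_n) be real sequences, let x, y be real numbers, and let p_{−2}, p_{−1}, p_0, …, p_N and q_0, q_1, …, q_{N+2} be real numbers with p_{−2} = p_{−1} = 0 and q_0 = 0, such that x·p_k = p_{k+1} + b_k·p_k + c_k·p_{k−1} + d_k·p_{k−2} for 0 ≤ k ≤ N−1 and y·q_k = q_{k−1} + b_{k−1}·q_k + c_k·q_{k+1} + d_{k+1}·q_{k+2} for 1 ≤ k ≤ N. Then the Christoffel–Darboux identity holds: (x−y)·Σ_{k=0}^{N−1} p_k·q_{k+1} = p_N·q_N − c_N·p_{N−1}·q_{N+1} − d_N·p_{N−2}·q_{N+1} − d_{N+1}·p_{N−1}·q_{N+2}. -/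
/-- Christoffel–Darboux identity for the four-term recurrence: if `(p_k)` satisfies the
forward recurrence at `x` (with `p_{-2} = p_{-1} = 0`, encoded via `c_0 = d_0 = d_1 = 0`)
and `(q_k)` satisfies the backward recurrence at `y` (with `q_0 = 0`), then
`(x-y)·Σ_{k=0}^{N-1} p_k q_{k+1} = p_N q_N - c_N p_{N-1} q_{N+1} - d_N p_{N-2} q_{N+1}
  - d_{N+1} p_{N-1} q_{N+2}`. -/
theorem christoffel_darboux_four_term
    (b c d : ℕ → ℝ) (hc0 : c 0 = 0) (hd0 : d 0 = 0) (hd1 : d 1 = 0)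
    (N : ℕ) (x y : ℝ) (p q : ℕ → ℝ) (hq0 : q 0 = 0)
    (hp : ∀ k < N, x * p k = p (k + 1) + b k * p k + c k * p (k - 1) + d k * p (k - 2))
    (hq : ∀ k : ℕ, 1 ≤ k → k ≤ N →
      y * q k = q (k - 1) + b (k - 1) * q k + c k * q (k + 1) + d (k + 1) * q (k + 2)) :
    (x - y) * ∑ k ∈ Finset.range N, p k * q (k + 1) =
      p N * q N - c N * p (N - 1) * q (N + 1) - d N * p (N - 2) * q (N + 1)
        - d (N + 1) * p (N - 1) * q (N + 2) := by
  induction N with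
  | zero => simp [hq0, hc0, hd0, hd1]
  | succ n ih =>
    have hsum := ih (fun k hk => hp k (by lia)) (fun k h1 hk => hq k h1 (by lia))
    have hpn := hp n n.lt_succ_self
    have hqn := hq (n + 1) (by lia) le_rfl
    have hsub : n + 1 - 2 = n - 1 := by lia
    simp only [Nat.add_sub_cancel, add_assoc, Nat.reduceAdd] at hqn
    rw [Finset.sum_range_succ, mul_add, hsum]
    simp only [hsub, Nat.add_sub_cancel, add_assoc, Nat.reduceAdd]
    linear_combination q (n + 1) * hpn - p n * hqn
end

section
/- Let (P_n)_{n≥0} be the monic polynomials generated by the four-term recurrence with coefficients (b_n), (c_n), (d_n), let x* be a real number with P_N(x*) = 0, and let u_0, u_1, …, u_{N+2} be real numbers with u_0 = 0 and u_{N+1} = u_{N+2} = 0 satisfying the backward recurrence x*·u_k = u_{k−1} + b_{k−1}·u_k + c_k·u_{k+1} + d_{k+1}·u_{k+2} for 1 ≤ k ≤ N. Then for every real x, (x − x*)·Σ_{k=0}^{N−1} P_k(x)·u_{k+1} = P_N(x)·u_N. -/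
open Polynomial

/-- The partial sums of the Christoffel-Darboux sum at a zero telescope, up to boundary terms. -/
theorem christoffel_darboux_partial_sum
    (b c d : ℕ → ℝ) (hc0 : c 0 = 0) (hd0 : d 0 = 0) (hd1 : d 1 = 0)
    (P : ℕ → Polynomial ℝ)
    (hrec : ∀ n : ℕ, P (n + 1) =
      (X - C (b n)) * P n - C (c n) * P (n - 1) - C (d n) * P (n - 2))
    (N : ℕ) (y : ℝ) (u : ℕ → ℝ) (hu0 : u 0 = 0)
    (hurec : ∀ k : ℕ, 1 ≤ k → k ≤ N →
      y * u k = u (k - 1) + b (k - 1) * u k + c k * u (k + 1) + d (k + 1) * u (k + 2))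
    (x : ℝ) (M : ℕ) (hM : M ≤ N) :
    (x - y) * ∑ k ∈ Finset.range M, (P k).eval x * u (k + 1) =
      (P M).eval x * u M - c M * (P (M - 1)).eval x * u (M + 1)
        - d M * (P (M - 2)).eval x * u (M + 1)
        - d (M + 1) * (P (M - 1)).eval x * u (M + 2) := by
  induction M with
  | zero => simp [hu0, hc0, hd0, hd1]
  | succ M ih =>
    have hP := congrArg (Polynomial.eval x) (hrec M)
    simp only [eval_sub, eval_mul, eval_X, eval_C] at hP
    have hu := hurec (M + 1) (by omega) hM
    simp only [Nat.add_sub_cancel] at hu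
    rw [Finset.sum_range_succ, mul_add, ih (by omega), show M + 1 - 2 = M - 1 by omega,
      Nat.add_sub_cancel]
    linear_combination (-u (M + 1)) * hP - (P M).eval x * hu

/-- If `x*` is a zero of `P_N` and `(u_k)` solves the backward recurrence with boundary
conditions `u_0 = 0`, `u_{N+1} = u_{N+2} = 0`, then for every real `x`,
`(x - x*)·Σ_{k=0}^{N-1} P_k(x)·u_{k+1} = P_N(x)·u_N`. -/
theorem christoffel_darboux_at_zero
    (b c d : ℕ → ℝ) (hc0 : c 0 = 0) (hd0 : d 0 = 0) (hd1 : d 1 = 0)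
    (P : ℕ → Polynomial ℝ) (hP0 : P 0 = 1)
    (hrec : ∀ n : ℕ, P (n + 1) =
      (X - C (b n)) * P n - C (c n) * P (n - 1) - C (d n) * P (n - 2))
    (N : ℕ) (xstar : ℝ) (hroot : (P N).eval xstar = 0)
    (u : ℕ → ℝ) (hu0 : u 0 = 0) (huN1 : u (N + 1) = 0) (huN2 : u (N + 2) = 0)
    (hurec : ∀ k : ℕ, 1 ≤ k → k ≤ N →
      xstar * u k = u (k - 1) + b (k - 1) * u k + c k * u (k + 1) + d (k + 1) * u (k + 2)) :
    ∀ x : ℝ, (x - xstar) * ∑ k ∈ Finset.range N, (P k).eval x * u (k + 1) =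
      (P N).eval x * u N := by
  intro x
  rw [christoffel_darboux_partial_sum b c d hc0 hd0 hd1 P hrec N xstar u hu0 hurec x N le_rfl,
    huN1, huN2]
  ring
end

section
/- Let (P_n)_{n≥0} be the monic polynomials generated by the four-term recurrence with coefficients (b_n), (c_n), (d_n), let x* be a real number with P_N(x*) = 0, and let u_0, u_1, …, u_{N+2} be real numbers with u_0 = 0 and u_{N+1} = u_{N+2} = 0 satisfying the backward recurrence x*·u_k = u_{k−1} + b_{k−1}·u_k + c_k·u_{k+1} + d_{k+1}·u_{k+2} for 1 ≤ k ≤ N. Then Σ_{k=0}^{N−1} P_k(x*)·u_{k+1} = P_N′(x*)·u_N, where P_N′ denotes the derivative of P_N. -/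
open Polynomial

/-- The partial Christoffel–Darboux sums for the derivatives telescope. -/
theorem sum_eval_mul_eq_derivative_eval
    (b c d : ℕ → ℝ) (hc0 : c 0 = 0) (hd0 : d 0 = 0) (hd1 : d 1 = 0)
    (P : ℕ → Polynomial ℝ) (hP0 : P 0 = 1)
    (hrec : ∀ n : ℕ, P (n + 1) =
      (X - C (b n)) * P n - C (c n) * P (n - 1) - C (d n) * P (n - 2))
    (N : ℕ) (x : ℝ) (u : ℕ → ℝ)
    (hurec : ∀ k : ℕ, 1 ≤ k → k ≤ N →
      x * u k = u (k - 1) + b (k - 1) * u k + c k * u (k + 1) + d (k + 1) * u (k + 2))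
    (m : ℕ) (hm : m ≤ N) :
    ∑ k ∈ Finset.range m, (P k).eval x * u (k + 1) =
      (derivative (P m)).eval x * u m - c m * (derivative (P (m - 1))).eval x * u (m + 1)
        - d (m + 1) * (derivative (P (m - 1))).eval x * u (m + 2)
        - d m * (derivative (P (m - 2))).eval x * u (m + 1) := by
  induction m with
  | zero => simp [hP0, hc0, hd0, hd1]
  | succ k ih =>
    have hder : (derivative (P (k + 1))).eval x = (P k).eval x
        + (x - b k) * (derivative (P k)).eval x - c k * (derivative (P (k - 1))).eval x
        - d k * (derivative (P (k - 2))).eval x := by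
      rw [hrec k]
      simp
    have hu := hurec (k + 1) (by omega) hm
    rw [Finset.sum_range_succ, ih (by omega), hder]
    simp only [Nat.add_sub_cancel, show k + 1 - 2 = k - 1 by omega] at hu ⊢
    linear_combination (-(derivative (P k)).eval x) * hu

/-- Confluent form of the Christoffel–Darboux identity at a zero `x*` of `P_N`:
`Σ_{k=0}^{N-1} P_k(x*)·u_{k+1} = P_N′(x*)·u_N`. -/
theorem christoffel_darboux_confluent
    (b c d : ℕ → ℝ) (hc0 : c 0 = 0) (hd0 : d 0 = 0) (hd1 : d 1 = 0)
    (P : ℕ → Polynomial ℝ) (hP0 : P 0 = 1)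
    (hrec : ∀ n : ℕ, P (n + 1) =
      (X - C (b n)) * P n - C (c n) * P (n - 1) - C (d n) * P (n - 2))
    (N : ℕ) (xstar : ℝ) (hroot : (P N).eval xstar = 0)
    (u : ℕ → ℝ) (hu0 : u 0 = 0) (huN1 : u (N + 1) = 0) (huN2 : u (N + 2) = 0)
    (hurec : ∀ k : ℕ, 1 ≤ k → k ≤ N →
      xstar * u k = u (k - 1) + b (k - 1) * u k + c k * u (k + 1) + d (k + 1) * u (k + 2)) :
    ∑ k ∈ Finset.range N, (P k).eval xstar * u (k + 1) =
      (Polynomial.derivative (P N)).eval xstar * u N := by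
  rw [sum_eval_mul_eq_derivative_eval b c d hc0 hd0 hd1 P hP0 hrec N xstar u hurec N le_rfl,
    huN1, huN2]
  ring
end

section
/- Let μ₁ be a positive Borel measure on ℝ with finite moments of all orders, let (P_n)_{n≥0} be the monic polynomials generated by the four-term recurrence with coefficients (b_n), (c_n), (d_n), and assume ∫ P_k(x) dμ₁(x) = 0 for all 1 ≤ k ≤ N−1. Let x* be a real number with P_N(x*) = 0 and P_N′(x*) ≠ 0, and let u_0, …, u_{N+2} be real numbers with u_0 = 0 and u_{N+1} = u_{N+2} = 0 satisfying the backward recurrence x*·u_k = u_{k−1} + b_{k−1}·u_k + c_k·u_{k+1} + d_{k+1}·u_{k+2} for 1 ≤ k ≤ N. Define λ = ∫ P_N(x)/((x − x*)·P_N′(x*)) dμ₁(x). Then λ·P_N′(x*)·u_N = u_1·μ₁(ℝ). -/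
open MeasureTheory Polynomial

/-- The Christoffel–Darboux identity for a four-term recurrence: a partial sum against a solution
`u` of the dual recurrence at `t`, multiplied by `X - t`, reduces to boundary terms. -/
theorem X_sub_C_mul_sum_dual_recurrence {R : Type*} [CommRing R]
    {b c d : ℕ → R} (hc0 : c 0 = 0) (hd0 : d 0 = 0) (hd1 : d 1 = 0)
    {P : ℕ → R[X]}
    (hrec : ∀ n : ℕ, P (n + 1) =
      (X - C (b n)) * P n - C (c n) * P (n - 1) - C (d n) * P (n - 2))
    {N : ℕ} {t : R} {u : ℕ → R} (hu0 : u 0 = 0)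
    (hurec : ∀ k : ℕ, 1 ≤ k → k ≤ N →
      t * u k = u (k - 1) + b (k - 1) * u k + c k * u (k + 1) + d (k + 1) * u (k + 2))
    {m : ℕ} (hm : m ≤ N) :
    (X - C t) * ∑ k ∈ Finset.range m, C (u (k + 1)) * P k =
      C (u m) * P m - C (c m * u (m + 1) + d (m + 1) * u (m + 2)) * P (m - 1)
        - C (d m * u (m + 1)) * P (m - 2) := by
  induction m with
  | zero => simp [hu0, hc0, hd0, hd1]
  | succ m ih =>
    have hC := congrArg (C : R → R[X]) (hurec (m + 1) (by omega) hm)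
    have hsub : m + 1 - 2 = m - 1 := by omega
    rw [Finset.sum_range_succ, mul_add, ih (by omega), hsub, hrec m]
    simp only [Nat.add_sub_cancel, map_add, map_mul, add_assoc, Nat.reduceAdd] at hC ⊢
    linear_combination (-P m) * hC

/-- Integrating the Christoffel–Darboux identity at a zero `x*` of `P_N` against `μ₁`:
if `∫ P_k dμ₁ = 0` for `1 ≤ k ≤ N-1`, then the quadrature weight
`λ = ∫ P_N(x)/((x-x*)·P_N′(x*)) dμ₁(x)` satisfies `λ·P_N′(x*)·u_N = u_1·μ₁(ℝ)`. -/
theorem quadrature_weight_first_measure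
    (μ₁ : Measure ℝ)
    (hint : ∀ p : Polynomial ℝ, Integrable (fun x => p.eval x) μ₁)
    (b c d : ℕ → ℝ) (hc0 : c 0 = 0) (hd0 : d 0 = 0) (hd1 : d 1 = 0)
    (P : ℕ → Polynomial ℝ) (hP0 : P 0 = 1)
    (hrec : ∀ n : ℕ, P (n + 1) =
      (X - C (b n)) * P n - C (c n) * P (n - 1) - C (d n) * P (n - 2))
    (N : ℕ)
    (horth : ∀ k : ℕ, 1 ≤ k → k < N → ∫ x, (P k).eval x ∂μ₁ = 0)
    (xstar : ℝ) (hroot : (P N).eval xstar = 0)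
    (hder : (Polynomial.derivative (P N)).eval xstar ≠ 0)
    (u : ℕ → ℝ) (hu0 : u 0 = 0) (huN1 : u (N + 1) = 0) (huN2 : u (N + 2) = 0)
    (hurec : ∀ k : ℕ, 1 ≤ k → k ≤ N →
      xstar * u k = u (k - 1) + b (k - 1) * u k + c k * u (k + 1) + d (k + 1) * u (k + 2))
    (lam : ℝ)
    (hlam : lam = (∫ x, ((P N) /ₘ (X - C xstar)).eval x ∂μ₁) /
      (Polynomial.derivative (P N)).eval xstar) :
    lam * (Polynomial.derivative (P N)).eval xstar * u N = u 1 * (μ₁ Set.univ).toReal := by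
  have hN : 0 < N := by
    rcases Nat.eq_zero_or_pos N with rfl | h
    · simp [hP0] at hroot
    · exact h
  have hsum : ∑ k ∈ Finset.range N, C (u (k + 1)) * P k =
      C (u N) * (P N /ₘ (X - C xstar)) := by
    refine mul_left_cancel₀ (X_sub_C_ne_zero xstar) ?_
    rw [X_sub_C_mul_sum_dual_recurrence hc0 hd0 hd1 hrec hu0 hurec le_rfl, huN1, huN2,
      mul_left_comm, mul_divByMonic_eq_iff_isRoot.mpr hroot]
    simp
  have hintegral : ∫ x, (∑ k ∈ Finset.range N, C (u (k + 1)) * P k).eval x ∂μ₁ =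
      u 1 * (μ₁ Set.univ).toReal := by
    simp only [eval_finsetSum, eval_mul, eval_C]
    rw [integral_finsetSum _ fun k _ => (hint (P k)).const_mul _]
    simp only [integral_const_mul]
    rw [Finset.sum_eq_single_of_mem 0 (Finset.mem_range.mpr hN) fun k hk hk0 => by
      rw [horth k (Nat.one_le_iff_ne_zero.mpr hk0) (Finset.mem_range.mp hk), mul_zero]]
    simp [hP0, Measure.real]
  rw [hlam, div_mul_cancel₀ _ hder, ← hintegral, hsum]
  simp only [eval_mul, eval_C, integral_const_mul]
  exact mul_comm _ _
end

section
/- Let μ₂ be a positive Borel measure on ℝ with finite moments of all orders, let (P_n)_{n≥0} be the monic polynomials generated by the four-term recurrence with coefficients (b_n), (c_n), (d_n), and assume ∫ P_k(x) dμ₂(x) = 0 for all 2 ≤ k ≤ N−1. Let x* be a real number with P_N(x*) = 0 and P_N′(x*) ≠ 0, and let u_0, …, u_{N+2} be real numbers with u_0 = 0 and u_{N+1} = u_{N+2} = 0 satisfying the backward recurrence x*·u_k = u_{k−1} + b_{k−1}·u_k + c_k·u_{k+1} + d_{k+1}·u_{k+2} for 1 ≤ k ≤ N. Define λ = ∫ P_N(x)/((x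 − x*)·P_N′(x*)) dμ₂(x). Then λ·P_N′(x*)·u_N = u_1·μ₂(ℝ) + u_2·∫ P_1(x) dμ₂(x). -/
open MeasureTheory Polynomial

/-- Christoffel–Darboux type partial summation for a four-term recurrence and a solution `u` of the
transposed recurrence at the point `t`. -/
theorem four_term_christoffel_darboux {R : Type*} [CommRing R]
    (b c d : ℕ → R) (hc0 : c 0 = 0) (hd0 : d 0 = 0) (hd1 : d 1 = 0) (P : ℕ → Polynomial R)
    (hrec : ∀ n : ℕ, P (n + 1) =
      (X - C (b n)) * P n - C (c n) * P (n - 1) - C (d n) * P (n - 2))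
    (N : ℕ) (t : R) (u : ℕ → R) (hu0 : u 0 = 0)
    (hurec : ∀ k : ℕ, 1 ≤ k → k ≤ N →
      t * u k = u (k - 1) + b (k - 1) * u k + c k * u (k + 1) + d (k + 1) * u (k + 2))
    (M : ℕ) (hM : M ≤ N) :
    (X - C t) * ∑ k ∈ Finset.range M, C (u (k + 1)) * P k =
      C (u M) * P M - C (c M * u (M + 1) + d (M + 1) * u (M + 2)) * P (M - 1)
        - C (d M * u (M + 1)) * P (M - 2) := by
  induction M with
  | zero => simp [hu0, hc0, hd0, hd1]
  | succ M ih =>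
    have hu := congrArg (C : R → Polynomial R) (hurec (M + 1) (by omega) hM)
    have ih := ih (by omega)
    rw [Finset.sum_range_succ, mul_add, ih, hrec M]
    simp only [Nat.add_sub_cancel, show M + 1 - 2 = M - 1 by omega, map_add, map_mul] at hu ⊢
    linear_combination (-P M) * hu

/-- Integrating the Christoffel–Darboux identity at a zero `x*` of `P_N` against `μ₂`:
if `∫ P_k dμ₂ = 0` for `2 ≤ k ≤ N-1`, then the quadrature weight
`λ = ∫ P_N(x)/((x-x*)·P_N′(x*)) dμ₂(x)` satisfies
`λ·P_N′(x*)·u_N = u_1·μ₂(ℝ) + u_2·∫ P_1 dμ₂`. -/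
theorem quadrature_weight_second_measure
    (μ₂ : Measure ℝ)
    (hint : ∀ p : Polynomial ℝ, Integrable (fun x => p.eval x) μ₂)
    (b c d : ℕ → ℝ) (hc0 : c 0 = 0) (hd0 : d 0 = 0) (hd1 : d 1 = 0)
    (P : ℕ → Polynomial ℝ) (hP0 : P 0 = 1)
    (hrec : ∀ n : ℕ, P (n + 1) =
      (X - C (b n)) * P n - C (c n) * P (n - 1) - C (d n) * P (n - 2))
    (N : ℕ)
    (horth : ∀ k : ℕ, 2 ≤ k → k < N → ∫ x, (P k).eval x ∂μ₂ = 0)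
    (xstar : ℝ) (hroot : (P N).eval xstar = 0)
    (hder : (Polynomial.derivative (P N)).eval xstar ≠ 0)
    (u : ℕ → ℝ) (hu0 : u 0 = 0) (huN1 : u (N + 1) = 0) (huN2 : u (N + 2) = 0)
    (hurec : ∀ k : ℕ, 1 ≤ k → k ≤ N →
      xstar * u k = u (k - 1) + b (k - 1) * u k + c k * u (k + 1) + d (k + 1) * u (k + 2))
    (lam : ℝ)
    (hlam : lam = (∫ x, ((P N) /ₘ (X - C xstar)).eval x ∂μ₂) /
      (Polynomial.derivative (P N)).eval xstar) :
    lam * (Polynomial.derivative (P N)).eval xstar * u N =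
      u 1 * (μ₂ Set.univ).toReal + u 2 * ∫ x, (P 1).eval x ∂μ₂ := by
  obtain ⟨n, rfl⟩ : ∃ n, N = n + 1 := by
    refine Nat.exists_eq_succ_of_ne_zero ?_
    rintro rfl
    simp [hP0] at hroot
  have hsum : ∑ k ∈ Finset.range (n + 1), C (u (k + 1)) * P k =
      C (u (n + 1)) * (P (n + 1) /ₘ (X - C xstar)) := by
    refine mul_left_cancel₀ (X_sub_C_ne_zero xstar) ?_
    rw [four_term_christoffel_darboux b c d hc0 hd0 hd1 P hrec (n + 1) xstar u hu0 hurec _ le_rfl,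
      mul_left_comm, mul_divByMonic_eq_iff_isRoot.mpr hroot]
    simp [huN1, huN2]
  have hintegral : u (n + 1) * ∫ x, (P (n + 1) /ₘ (X - C xstar)).eval x ∂μ₂ =
      ∑ k ∈ Finset.range (n + 1), u (k + 1) * ∫ x, (P k).eval x ∂μ₂ := by
    simp_rw [← integral_const_mul]
    rw [← integral_finsetSum _ fun k _ => (hint (P k)).const_mul _]
    refine integral_congr_ae (.of_forall fun x => ?_)
    simpa [eval_finsetSum] using (congrArg (eval x) hsum).symm
  rw [hlam, div_mul_cancel₀ _ hder, mul_comm, hintegral]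
  have hP0int : ∫ x, (P 0).eval x ∂μ₂ = (μ₂ Set.univ).toReal := by
    simp [hP0, Measure.real]
  rcases n with _ | m
  · simp only [zero_add, Finset.sum_range_one, hP0int]
    simp [show u 2 = 0 from huN1]
  · rw [Finset.sum_range_succ', Finset.sum_range_succ', Finset.sum_eq_zero, hP0int]
    · ring
    · intro k hk
      rw [horth _ (by omega) (by have := Finset.mem_range.mp hk; omega), mul_zero]
end

section
/- Let μ₁, μ₂ be positive Borel measures on ℝ with finite moments of all orders, let (P_n)_{n≥0} be the monic polynomials generated by the four-term recurrence with coefficients (b_n), (c_n), (d_n), and assume ∫ P_k dμ₁ = 0 for 1 ≤ k ≤ N−1 and ∫ P_k dμ₂ = 0 for 2 ≤ k ≤ N−1. Let x* be a real number with P_N(x*) = 0 and P_N′(x*) ≠ 0, let u_0, …, u_{N+2} be real numbers with u_0 = 0 and u_{N+1} = u_{N+2} = 0 satisfying the backward recurrence x*·u_k = u_{k−1} + b_{k−1}·u_k + c_k·u_{k+1} + d_{k+1}·u_{k+2} for 1 ≤ k ≤ N, set u = (u_1,…,u_N) and v = (P_0(x*),…,P_{N−1}(x*)), and assume ⟨u,v⟩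 = Σ_{k=1}^{N} u_k·P_{k−1}(x*) ≠ 0. Let A₁ ≠ 0, A₂, B₂ ≠ 0 be real constants with A₁·μ₁(ℝ) = 1, A₂·μ₁(ℝ) + B₂·μ₂(ℝ) = 0 and B₂·∫ P_1 dμ₂ = 1, and let ((D₁₁, 0), (D₂₁, D₂₂)) be the inverse of the 2×2 matrix ((A₁, 0), (A₂, B₂)). Then the simultaneous Gaussian quadrature weights at x* satisfy λ^{(1)} := ∫ P_N(x)/((x−x*)·P_N′(x*)) dμ₁(x) = D₁₁·u_1/⟨u,v⟩ and λ^{(2)} := ∫ P_N(x)/((x−x*)·P_N′(x*)) dμ₂(x) = (D₂₁·u_1 + D₂₂·u_2)/⟨u,v⟩. -/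
open MeasureTheory Polynomial Matrix

/-- Telescoped partial sums of a left eigenvector paired with the recurrence polynomials. -/
theorem X_sub_C_mul_sum_recurrence {R : Type*} [CommRing R] {b c d : ℕ → R}
    (hc0 : c 0 = 0) (hd0 : d 0 = 0) (hd1 : d 1 = 0) {P : ℕ → R[X]}
    (hrec : ∀ n : ℕ, P (n + 1) =
      (X - C (b n)) * P n - C (c n) * P (n - 1) - C (d n) * P (n - 2))
    {N : ℕ} {t : R} {u : ℕ → R} (hu0 : u 0 = 0)
    (hurec : ∀ k : ℕ, 1 ≤ k → k ≤ N →
      t * u k = u (k - 1) + b (k - 1) * u k + c k * u (k + 1) + d (k + 1) * u (k + 2))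
    {n : ℕ} (hn : n ≤ N) :
    (X - C t) * ∑ k ∈ Finset.range n, C (u (k + 1)) * P k =
      C (u n) * P n - C (c n * u (n + 1) + d (n + 1) * u (n + 2)) * P (n - 1)
        - C (d n * u (n + 1)) * P (n - 2) := by
  induction n with
  | zero => simp [hu0, hc0, hd0, hd1]
  | succ n ih =>
    have h := congrArg (C : R → R[X]) (hurec (n + 1) (by omega) hn)
    have hs : n + 1 - 2 = n - 1 := by omega
    rw [Finset.sum_range_succ, mul_add, ih (by omega), hs, hrec n]
    simp only [Nat.add_sub_cancel, map_add, map_mul, add_assoc, Nat.reduceAdd] at h ⊢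
    linear_combination (-P n) * h

/-- Integration of a finite combination of polynomials, term by term. -/
theorem integral_eval_sum_C_mul {μ : Measure ℝ}
    (hint : ∀ p : ℝ[X], Integrable (fun x => p.eval x) μ)
    (s : Finset ℕ) (a : ℕ → ℝ) (P : ℕ → ℝ[X]) :
    ∫ x, (∑ k ∈ s, C (a k) * P k).eval x ∂μ = ∑ k ∈ s, a k * ∫ x, (P k).eval x ∂μ := by
  simp only [eval_finsetSum, eval_mul, eval_C]
  rw [integral_finsetSum _ fun k _ => (hint (P k)).const_mul (a k)]
  simp only [integral_const_mul]

/-- Golub–Welsch type theorem for simultaneous Gaussian quadrature (case of two measures):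
the quadrature weights at an eigenvalue `x*` of the banded Hessenberg matrix are
`λ⁽¹⁾ = D₁₁·u₁/⟨u,v⟩` and `λ⁽²⁾ = (D₂₁·u₁ + D₂₂·u₂)/⟨u,v⟩`, where `u` is a left
eigenvector, `v = (P_0(x*),…,P_{N-1}(x*))` the right eigenvector with first component `1`,
and `D` is the inverse of the matrix `((A₁,0),(A₂,B₂))` of type I normalization constants. -/
theorem golub_welsch_simultaneous_quadrature
    (μ₁ μ₂ : Measure ℝ)
    (hint₁ : ∀ p : Polynomial ℝ, Integrable (fun x => p.eval x) μ₁)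
    (hint₂ : ∀ p : Polynomial ℝ, Integrable (fun x => p.eval x) μ₂)
    (b c d : ℕ → ℝ) (hc0 : c 0 = 0) (hd0 : d 0 = 0) (hd1 : d 1 = 0)
    (P : ℕ → Polynomial ℝ) (hP0 : P 0 = 1)
    (hrec : ∀ n : ℕ, P (n + 1) =
      (X - C (b n)) * P n - C (c n) * P (n - 1) - C (d n) * P (n - 2))
    (N : ℕ)
    (horth₁ : ∀ k : ℕ, 1 ≤ k → k < N → ∫ x, (P k).eval x ∂μ₁ = 0)
    (horth₂ : ∀ k : ℕ, 2 ≤ k → k < N → ∫ x, (P k).eval x ∂μ₂ = 0)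
    (xstar : ℝ) (hroot : (P N).eval xstar = 0)
    (hder : (Polynomial.derivative (P N)).eval xstar ≠ 0)
    (u : ℕ → ℝ) (hu0 : u 0 = 0) (huN1 : u (N + 1) = 0) (huN2 : u (N + 2) = 0)
    (hurec : ∀ k : ℕ, 1 ≤ k → k ≤ N →
      xstar * u k = u (k - 1) + b (k - 1) * u k + c k * u (k + 1) + d (k + 1) * u (k + 2))
    (S : ℝ) (hS : S = ∑ k ∈ Finset.range N, u (k + 1) * (P k).eval xstar) (hSne : S ≠ 0)
    (A₁ A₂ B₂ : ℝ) (hA₁ : A₁ ≠ 0) (hB₂ : B₂ ≠ 0)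
    (hA₁μ : A₁ * (μ₁ Set.univ).toReal = 1)
    (hAB : A₂ * (μ₁ Set.univ).toReal + B₂ * (μ₂ Set.univ).toReal = 0)
    (hB₂P₁ : B₂ * ∫ x, (P 1).eval x ∂μ₂ = 1)
    (D₁₁ D₂₁ D₂₂ : ℝ)
    (hD : !![D₁₁, 0; D₂₁, D₂₂] * !![A₁, 0; A₂, B₂] = 1) :
    (∫ x, ((P N) /ₘ (X - C xstar)).eval x ∂μ₁) / (Polynomial.derivative (P N)).eval xstar
      = D₁₁ * u 1 / S ∧
    (∫ x, ((P N) /ₘ (X - C xstar)).eval x ∂μ₂) / (Polynomial.derivative (P N)).eval xstar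
      = (D₂₁ * u 1 + D₂₂ * u 2) / S := by
  set W : ℝ[X] := ∑ k ∈ Finset.range N, C (u (k + 1)) * P k with hW
  set Q : ℝ[X] := P N /ₘ (X - C xstar) with hQ
  have hPQ : (X - C xstar) * Q = P N := mul_divByMonic_eq_iff_isRoot.mpr hroot
  have hWQ : W = C (u N) * Q := by
    refine mul_left_cancel₀ (X_sub_C_ne_zero xstar) ?_
    rw [hW, X_sub_C_mul_sum_recurrence hc0 hd0 hd1 hrec hu0 hurec le_rfl, huN1, huN2,
      ← hPQ]
    simp only [mul_zero, add_zero, map_zero, zero_mul, sub_zero]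
    ring
  have hQder : Q.eval xstar = (derivative (P N)).eval xstar := by
    simp [← hPQ]
  have hSder : S = u N * (derivative (P N)).eval xstar := by
    rw [hS, ← hQder, ← eval_C_mul, ← hWQ, hW]
    simp [eval_finsetSum]
  have huN : u N ≠ 0 := left_ne_zero_of_mul (hSder ▸ hSne)
  have weight (μ : Measure ℝ) :
      (∫ x, Q.eval x ∂μ) / (derivative (P N)).eval xstar = (∫ x, W.eval x ∂μ) / S := by
    rw [hWQ, hSder]
    simp only [eval_mul, eval_C, integral_const_mul]
    rw [mul_div_mul_left _ _ huN]
  obtain ⟨m, rfl⟩ : ∃ m, N = m + 1 := by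
    refine Nat.exists_eq_succ_of_ne_zero ?_
    rintro rfl
    simp [hP0] at hroot
  have hW₁ : ∫ x, W.eval x ∂μ₁ = u 1 * (μ₁ Set.univ).toReal := by
    rw [hW, integral_eval_sum_C_mul hint₁ _ (fun k => u (k + 1)), Finset.sum_range_succ',
      Finset.sum_eq_zero fun k hk => ?_]
    · simp [hP0, Measure.real]
    · rw [horth₁ (k + 1) (by omega) (by simpa using hk), mul_zero]
  have hW₂ : ∫ x, W.eval x ∂μ₂
      = u 1 * (μ₂ Set.univ).toReal + u 2 * ∫ x, (P 1).eval x ∂μ₂ := by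
    rw [hW, integral_eval_sum_C_mul hint₂ _ (fun k => u (k + 1)), Finset.sum_range_succ']
    rcases m with _ | m
    · simp [hP0, Measure.real, huN1]
    · rw [Finset.sum_range_succ', Finset.sum_eq_zero fun k hk => ?_]
      · simp [hP0, Measure.real, add_comm]
      · rw [horth₂ (k + 1 + 1) (by omega) (by simpa using hk), mul_zero]
  have hD₁₁ : D₁₁ * A₁ = 1 := by simpa using congrFun (congrFun hD 0) 0
  have hD₂₁ : D₂₁ * A₁ + D₂₂ * A₂ = 0 := by simpa using congrFun (congrFun hD 1) 0
  have hD₂₂ : D₂₂ * B₂ = 1 := by simpa using congrFun (congrFun hD 1) 1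
  have e₁₁ : D₁₁ = (μ₁ Set.univ).toReal := by
    linear_combination (μ₁ Set.univ).toReal * hD₁₁ - D₁₁ * hA₁μ
  have e₂₂ : D₂₂ = ∫ x, (P 1).eval x ∂μ₂ := by
    linear_combination (∫ x, (P 1).eval x ∂μ₂) * hD₂₂ - D₂₂ * hB₂P₁
  have e₂₁ : D₂₁ = (μ₂ Set.univ).toReal := by
    linear_combination (μ₁ Set.univ).toReal * hD₂₁ - D₂₁ * hA₁μ - D₂₂ * hAB
      + (μ₂ Set.univ).toReal * hD₂₂
  rw [weight, weight, hW₁, hW₂, ← e₁₁, ← e₂₁, ← e₂₂]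
  constructor <;> ring
end

section
/- Let ν ≥ 0 be a real number and define ρ_ν(x) = x^ν · ∫_0^∞ exp(−t − x/t)·t^{−ν−1} dt for x > 0. Then for every natural number n, ∫_0^∞ x^n · ρ_ν(x) dx = Γ(n+ν+1) · Γ(n+1), where Γ is the Gamma function. -/
open MeasureTheory

/-- The integrand of the double integral behind the moments of `ρ_ν`. -/
noncomputable def besselMomentIntegrand (a ν x t : ℝ) : ℝ :=
  x ^ a * (Real.exp (-t - x / t) * t ^ (-ν - 1))

theorem besselMomentIntegrand_eq (a ν x t : ℝ) :
    besselMomentIntegrand a ν x t =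
      Real.exp (-t) * t ^ (-ν - 1) * (x ^ a * Real.exp (-(t⁻¹ * x))) := by
  rw [besselMomentIntegrand, sub_eq_add_neg, Real.exp_add, div_eq_inv_mul]
  ring

theorem measurable_uncurry_besselMomentIntegrand (a ν : ℝ) :
    Measurable (Function.uncurry (besselMomentIntegrand a ν)) := by
  unfold Function.uncurry besselMomentIntegrand
  fun_prop

theorem integrableOn_besselMomentIntegrand_left {a : ℝ} (ha : -1 < a) (ν : ℝ) {t : ℝ}
    (ht : 0 < t) :
    IntegrableOn (fun x => besselMomentIntegrand a ν x t) (Set.Ioi 0) := by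
  simp only [besselMomentIntegrand_eq]
  refine Integrable.const_mul ?_ _
  simpa [IntegrableOn] using
    integrableOn_rpow_mul_exp_neg_mul_rpow ha one_pos (inv_pos.mpr ht)

theorem integral_besselMomentIntegrand_left {a : ℝ} (ha : -1 < a) (ν : ℝ) {t : ℝ}
    (ht : 0 < t) :
    ∫ x in Set.Ioi (0 : ℝ), besselMomentIntegrand a ν x t =
      Real.Gamma (a + 1) * (Real.exp (-t) * t ^ (a - ν + 1 - 1)) := by
  simp only [besselMomentIntegrand_eq]
  rw [integral_const_mul]
  have h := Real.integral_rpow_mul_exp_neg_mul_Ioi (a := a + 1) (by linarith) (inv_pos.mpr ht)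
  rw [add_sub_cancel_right, one_div, inv_inv] at h
  rw [h, show a - ν + 1 - 1 = (-ν - 1) + (a + 1) by ring, Real.rpow_add ht (-ν - 1)]
  ring

theorem integrable_uncurry_besselMomentIntegrand {a ν : ℝ} (ha : -1 < a) (hν : ν < a + 1) :
    Integrable (Function.uncurry (besselMomentIntegrand a ν))
      ((volume.restrict (Set.Ioi 0)).prod (volume.restrict (Set.Ioi 0))) := by
  rw [integrable_prod_iff' (measurable_uncurry_besselMomentIntegrand a ν).aestronglyMeasurable]
  refine ⟨(ae_restrict_mem measurableSet_Ioi).mono fun t ht =>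
    integrableOn_besselMomentIntegrand_left ha ν ht, ?_⟩
  refine ((Real.GammaIntegral_convergent (s := a - ν + 1) (by linarith)).const_mul
    (Real.Gamma (a + 1))).congr ?_
  filter_upwards [ae_restrict_mem measurableSet_Ioi] with t ht
  rw [← integral_besselMomentIntegrand_left ha ν ht]
  refine setIntegral_congr_fun measurableSet_Ioi fun x hx => ?_
  have hx' : 0 < x := hx
  have ht' : 0 < t := ht
  refine (Real.norm_of_nonneg ?_).symm
  simp only [besselMomentIntegrand]
  positivity

/-- Moments of the modified Bessel weight `ρ_ν(x) = 2 x^{ν/2} K_ν(2√x)`: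
`∫_0^∞ x^n ρ_ν(x) dx = Γ(n+ν+1)·Γ(n+1)`. -/
theorem bessel_K_weight_moments
    (ν : ℝ) (hν : 0 ≤ ν)
    (ρ : ℝ → ℝ)
    (hρ : ∀ x : ℝ, 0 < x →
      ρ x = x ^ ν * ∫ t in Set.Ioi (0 : ℝ), Real.exp (-t - x / t) * t ^ (-ν - 1)) :
    ∀ n : ℕ, ∫ x in Set.Ioi (0 : ℝ), x ^ n * ρ x =
      Real.Gamma (n + ν + 1) * Real.Gamma (n + 1) := by
  intro n
  have hn : (0 : ℝ) ≤ n := n.cast_nonneg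
  have ha : -1 < (n : ℝ) + ν := by linarith
  calc ∫ x in Set.Ioi (0 : ℝ), x ^ n * ρ x
      = ∫ x in Set.Ioi (0 : ℝ), ∫ t in Set.Ioi (0 : ℝ), besselMomentIntegrand (n + ν) ν x t := by
        refine setIntegral_congr_fun measurableSet_Ioi fun x hx => ?_
        simp only [besselMomentIntegrand]
        rw [integral_const_mul, hρ x hx, Real.rpow_add hx, Real.rpow_natCast, mul_assoc]
    _ = ∫ t in Set.Ioi (0 : ℝ), ∫ x in Set.Ioi (0 : ℝ), besselMomentIntegrand (n + ν) ν x t :=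
        integral_integral_swap (integrable_uncurry_besselMomentIntegrand ha (by linarith))
    _ = ∫ t in Set.Ioi (0 : ℝ),
          Real.Gamma (n + ν + 1) * (Real.exp (-t) * t ^ ((n : ℝ) + 1 - 1)) := by
        refine setIntegral_congr_fun measurableSet_Ioi fun t ht => ?_
        simp only [integral_besselMomentIntegrand_left ha ν ht, add_sub_cancel_right]
    _ = Real.Gamma (n + ν + 1) * Real.Gamma (n + 1) := by
        rw [integral_const_mul, ← Real.Gamma_eq_integral (by linarith)]
end

section
/- Let ν ≥ 0 and α be real numbers, let ρ_ν(x) = x^ν · ∫_0^∞ exp(−t − x/t)·t^{−ν−1} dt for x > 0, and set w₁(x) = x^α·ρ_ν(x) and w₂(x) = x^α·ρ_{ν+1}(x). Then the vector Pearson equation holds: for every x > 0, the function t ↦ t·w₁(t) has derivative at x equal to (α+ν+1)·w₁(x) − w₂(x), and the function t ↦ t·w₂(t) has derivative at x equal to −x·w₁(x) + (α+1)·w₂(x). -/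
open MeasureTheory

open Set Filter Topology

/-- A negative power of `t` is dominated by the factor `exp (x / t)`, uniformly in `t > 0`. -/
lemma exp_neg_div_mul_rpow_neg_le {p x t : ℝ} (hp : 0 < p) (hx : 0 < x) (ht : 0 < t) :
    Real.exp (-(x / t)) * t ^ (-p) ≤ (p / x) ^ p := by
  have h1 : x / (p * t) ≤ Real.exp (x / (p * t)) := by
    linarith [Real.add_one_le_exp (x / (p * t))]
  have h2 : (x / (p * t)) ^ p ≤ Real.exp (x / t) := by
    calc (x / (p * t)) ^ p ≤ (Real.exp (x / (p * t))) ^ p :=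
          Real.rpow_le_rpow (by positivity) h1 hp.le
      _ = Real.exp (x / t) := by
          rw [← Real.exp_mul]
          congr 1
          field_simp
  have h3 : t ^ (-p) = (p / x) ^ p * (x / (p * t)) ^ p := by
    rw [← Real.mul_rpow (by positivity) (by positivity), Real.rpow_neg ht.le,
      ← Real.inv_rpow ht.le]
    congr 1
    field_simp
  rw [h3, Real.exp_neg, inv_mul_le_iff₀ (Real.exp_pos _), mul_comm (Real.exp _)]
  gcongr

lemma exp_neg_sub_div_mul_rpow_neg_le {p x t : ℝ} (hp : 0 < p) (hx : 0 < x) (ht : 0 < t) :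
    Real.exp (-t - x / t) * t ^ (-p) ≤ (p / x) ^ p * Real.exp (-t) := by
  rw [sub_eq_add_neg, Real.exp_add, mul_assoc, mul_comm ((p / x) ^ p)]
  gcongr
  exact exp_neg_div_mul_rpow_neg_le hp hx ht

lemma continuousOn_exp_neg_sub_div_mul_rpow (p x : ℝ) :
    ContinuousOn (fun t : ℝ => Real.exp (-t - x / t) * t ^ p) (Ioi 0) := by
  intro t ht
  have ht' : t ≠ 0 := ne_of_gt ht
  apply ContinuousAt.continuousWithinAt
  fun_prop (disch := first | assumption | exact Or.inl ht')

lemma integrableOn_exp_neg_sub_div_mul_rpow_neg {p x : ℝ} (hp : 0 < p) (hx : 0 < x) :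
    IntegrableOn (fun t : ℝ => Real.exp (-t - x / t) * t ^ (-p)) (Ioi 0) := by
  refine Integrable.mono' ((integrableOn_exp_neg_Ioi 0).const_mul ((p / x) ^ p))
    ((continuousOn_exp_neg_sub_div_mul_rpow _ _).aestronglyMeasurable measurableSet_Ioi) ?_
  filter_upwards [ae_restrict_mem measurableSet_Ioi] with t ht
  have ht' : 0 < t := ht
  rw [Real.norm_of_nonneg (by positivity)]
  exact exp_neg_sub_div_mul_rpow_neg_le hp hx ht

/-- Differentiation under the integral sign for `∫ exp (-t - x / t) t ^ (-p) dt`. -/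
lemma hasDerivAt_integral_exp_neg_sub_div_mul_rpow_neg {p x : ℝ} (hp : 0 < p) (hx : 0 < x) :
    HasDerivAt (fun y : ℝ => ∫ t in Ioi (0 : ℝ), Real.exp (-t - y / t) * t ^ (-p))
      (-∫ t in Ioi (0 : ℝ), Real.exp (-t - x / t) * t ^ (-(p + 1))) x := by
  rw [← integral_neg]
  refine (hasDerivAt_integral_of_dominated_loc_of_deriv_le (μ := volume.restrict (Ioi 0))
    (F := fun y t : ℝ => Real.exp (-t - y / t) * t ^ (-p))
    (F' := fun y t : ℝ => -(Real.exp (-t - y / t) * t ^ (-(p + 1))))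
    (bound := fun t => Real.exp (-t - (x / 2) / t) * t ^ (-(p + 1)))
    (Ioi_mem_nhds (half_lt_self hx)) (Eventually.of_forall fun y => ?_)
    (integrableOn_exp_neg_sub_div_mul_rpow_neg hp hx) ?_ ?_
    (integrableOn_exp_neg_sub_div_mul_rpow_neg (by positivity) (by positivity)) ?_).2
  · exact (continuousOn_exp_neg_sub_div_mul_rpow _ _).aestronglyMeasurable measurableSet_Ioi
  · exact ((continuousOn_exp_neg_sub_div_mul_rpow _ _).aestronglyMeasurable
      measurableSet_Ioi).neg
  · filter_upwards [ae_restrict_mem measurableSet_Ioi] with t ht y hy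
    have ht' : 0 < t := ht
    rw [norm_neg, Real.norm_of_nonneg (by positivity)]
    have hy' : x / 2 ≤ y := le_of_lt hy
    gcongr
  · filter_upwards [ae_restrict_mem measurableSet_Ioi] with t ht y _
    have ht' : 0 < t := ht
    have h := ((((hasDerivAt_id y).div_const t).const_sub (-t)).exp).mul_const (t ^ (-p))
    refine h.congr_deriv ?_
    rw [neg_add, Real.rpow_add ht', Real.rpow_neg_one]
    simp only [id]
    ring

/-- The three-term recurrence obtained by integrating the derivative of
`exp (-t - x / t) t ^ (-p)` over `(0, ∞)`. -/
lemma integral_exp_neg_sub_div_mul_rpow_neg_recurrence {p x : ℝ} (hp : 0 < p) (hx : 0 < x) :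
    x * (∫ t in Ioi (0 : ℝ), Real.exp (-t - x / t) * t ^ (-(p + 2))) =
      (∫ t in Ioi (0 : ℝ), Real.exp (-t - x / t) * t ^ (-p)) +
        p * ∫ t in Ioi (0 : ℝ), Real.exp (-t - x / t) * t ^ (-(p + 1)) := by
  have i0 := integrableOn_exp_neg_sub_div_mul_rpow_neg hp hx
  have i1 := (integrableOn_exp_neg_sub_div_mul_rpow_neg (p := p + 1) (by positivity) hx).const_mul p
  have i2 := (integrableOn_exp_neg_sub_div_mul_rpow_neg (p := p + 2) (by positivity) hx).const_mul x
  have hzero : Real.exp (-0 - x / 0) * (0 : ℝ) ^ (-p) = 0 := by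
    rw [Real.zero_rpow (by linarith), mul_zero]
  have hcont : ContinuousWithinAt (fun t : ℝ => Real.exp (-t - x / t) * t ^ (-p)) (Ici 0) 0 := by
    rw [ContinuousWithinAt, hzero]
    have hlin : Tendsto (fun t : ℝ => ((p + 1) / x) ^ (p + 1) * t) (𝓝[≥] 0) (𝓝 0) := by
      have : Continuous fun t : ℝ => ((p + 1) / x) ^ (p + 1) * t := by fun_prop
      simpa using (this.tendsto 0).mono_left nhdsWithin_le_nhds
    refine squeeze_zero' ?_ ?_ hlin
    · filter_upwards [self_mem_nhdsWithin] with t ht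
      have ht' : 0 ≤ t := ht
      positivity
    · filter_upwards [self_mem_nhdsWithin] with t ht
      rcases (show 0 ≤ t from ht).eq_or_lt with rfl | ht'
      · rw [hzero, mul_zero]
      · have hb := exp_neg_sub_div_mul_rpow_neg_le (p := p + 1) (by positivity) hx ht'
        have he : Real.exp (-t) ≤ 1 := Real.exp_le_one_iff.2 (by linarith)
        have hsplit : t ^ (-p) = t ^ (-(p + 1)) * t := by
          rw [← Real.rpow_add_one ht'.ne']
          congr 1
          ring
        rw [hsplit, ← mul_assoc]
        gcongr
        exact hb.trans (mul_le_of_le_one_right (by positivity) he)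
  have htop : Tendsto (fun t : ℝ => Real.exp (-t - x / t) * t ^ (-p)) atTop (𝓝 0) := by
    have hexp : Tendsto (fun t : ℝ => (p / x) ^ p * Real.exp (-t)) atTop (𝓝 0) := by
      simpa using (Real.tendsto_exp_neg_atTop_nhds_zero).const_mul ((p / x) ^ p)
    refine squeeze_zero' ?_ ?_ hexp
    · filter_upwards [eventually_gt_atTop 0] with t ht
      positivity
    · filter_upwards [eventually_gt_atTop 0] with t ht
      exact exp_neg_sub_div_mul_rpow_neg_le hp hx ht
  have hderiv : ∀ t ∈ Ioi (0 : ℝ), HasDerivAt (fun t : ℝ => Real.exp (-t - x / t) * t ^ (-p))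
      (x * (Real.exp (-t - x / t) * t ^ (-(p + 2))) - Real.exp (-t - x / t) * t ^ (-p) -
        p * (Real.exp (-t - x / t) * t ^ (-(p + 1)))) t := by
    intro t ht
    have ht' : 0 < t := ht
    have h := (((hasDerivAt_id t).neg.sub ((hasDerivAt_const t x).div (hasDerivAt_id t)
      ht'.ne')).exp).mul (Real.hasDerivAt_rpow_const (p := -p) (Or.inl ht'.ne'))
    refine h.congr_deriv ?_
    have e1 : t ^ (-(p + 1)) = t ^ (-p) * t⁻¹ := by
      rw [neg_add, Real.rpow_add ht', Real.rpow_neg_one]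
    have e2 : t ^ (-(p + 2)) = t ^ (-p) * (t ^ 2)⁻¹ := by
      rw [neg_add, Real.rpow_add ht', Real.rpow_neg ht'.le 2, Real.rpow_two]
    have e3 : t ^ (-p - 1) = t ^ (-p) * t⁻¹ := by
      rw [Real.rpow_sub_one ht'.ne', div_eq_mul_inv]
    simp only [e1, e2, e3, Pi.neg_apply, Pi.sub_apply, Pi.div_apply, id]
    field_simp
    ring
  have i20 : Integrable (fun t : ℝ => x * (Real.exp (-t - x / t) * t ^ (-(p + 2))) -
      Real.exp (-t - x / t) * t ^ (-p)) (volume.restrict (Ioi 0)) := i2.sub i0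
  have key := integral_Ioi_of_hasDerivAt_of_tendsto hcont hderiv (i20.sub i1) htop
  rw [hzero, integral_sub i20 i1, integral_sub i2 i0, integral_const_mul,
    integral_const_mul] at key
  linarith

/-- The derivative of `y ^ q` times `∫ exp (-t - y / t) t ^ (-p) dt`. -/
lemma hasDerivAt_rpow_mul_integral_exp_neg_sub_div {p x : ℝ} (q : ℝ) (hp : 0 < p) (hx : 0 < x) :
    HasDerivAt (fun y : ℝ => y ^ (q + 1) *
        ∫ t in Ioi (0 : ℝ), Real.exp (-t - y / t) * t ^ (-p))
      (x ^ q * ((q + 1) * (∫ t in Ioi (0 : ℝ), Real.exp (-t - x / t) * t ^ (-p)) -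
        x * ∫ t in Ioi (0 : ℝ), Real.exp (-t - x / t) * t ^ (-(p + 1)))) x := by
  refine ((Real.hasDerivAt_rpow_const (p := q + 1) (Or.inl hx.ne')).mul
    (hasDerivAt_integral_exp_neg_sub_div_mul_rpow_neg hp hx)).congr_deriv ?_
  rw [add_sub_cancel_right, Real.rpow_add_one hx.ne']
  ring

/-- Vector Pearson equation for the modified Bessel weights
`(w₁, w₂) = x^α·(ρ_ν, ρ_{ν+1})`: for `x > 0`,
`(x·w₁)′ = (α+ν+1)·w₁ - w₂` and `(x·w₂)′ = -x·w₁ + (α+1)·w₂`. -/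
theorem bessel_K_vector_pearson
    (ν α : ℝ) (hν : 0 ≤ ν)
    (ρ : ℝ → ℝ → ℝ)
    (hρ : ∀ s x : ℝ, 0 < x →
      ρ s x = x ^ s * ∫ t in Set.Ioi (0 : ℝ), Real.exp (-t - x / t) * t ^ (-s - 1))
    (w₁ w₂ : ℝ → ℝ)
    (hw₁ : ∀ x : ℝ, w₁ x = x ^ α * ρ ν x)
    (hw₂ : ∀ x : ℝ, w₂ x = x ^ α * ρ (ν + 1) x) :
    ∀ x : ℝ, 0 < x →
      HasDerivAt (fun t => t * w₁ t) ((α + ν + 1) * w₁ x - w₂ x) x ∧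
      HasDerivAt (fun t => t * w₂ t) (-x * w₁ x + (α + 1) * w₂ x) x := by
  intro x hx
  have hw : ∀ (s : ℝ) {y : ℝ}, 0 < y → y ^ α * ρ s y =
      y ^ (α + s) * ∫ t in Ioi (0 : ℝ), Real.exp (-t - y / t) * t ^ (-(s + 1)) := by
    intro s y hy
    rw [hρ s y hy, Real.rpow_add hy, mul_assoc, neg_add']
  have hd : ∀ (s : ℝ) (w : ℝ → ℝ), 0 ≤ s → (∀ y, w y = y ^ α * ρ s y) →
      HasDerivAt (fun y => y * w y)
        (x ^ (α + s) *
          ((α + s + 1) * (∫ t in Ioi (0 : ℝ), Real.exp (-t - x / t) * t ^ (-(s + 1))) -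
            x * ∫ t in Ioi (0 : ℝ), Real.exp (-t - x / t) * t ^ (-(s + 1 + 1)))) x := by
    intro s w hs hws
    refine (hasDerivAt_rpow_mul_integral_exp_neg_sub_div (α + s) (by positivity) hx)
      |>.congr_of_eventuallyEq ?_
    filter_upwards [Ioi_mem_nhds hx] with y hy
    have hy' : 0 < y := hy
    rw [hws, hw s hy', Real.rpow_add_one hy'.ne']
    ring
  constructor
  · refine (hd ν w₁ hν hw₁).congr_deriv ?_
    rw [hw₁, hw₂, hw _ hx, hw _ hx, ← add_assoc, Real.rpow_add_one hx.ne']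
    ring
  · refine (hd (ν + 1) w₂ (by positivity) hw₂).congr_deriv ?_
    have hrec := integral_exp_neg_sub_div_mul_rpow_neg_recurrence (p := ν + 1) (by positivity) hx
    rw [show ν + 1 + 2 = ν + 1 + 1 + 1 by ring] at hrec
    rw [hrec, hw₁, hw₂, hw _ hx, hw _ hx, ← add_assoc, Real.rpow_add_one hx.ne']
    ring
end

section
/- Fix c > 0. For each real ν > −1 define the coefficients b_n^ν = (1 + c(ν+2n+1))/c², c_n^ν = n(2 + c(ν+n))/c³, d_n^ν = n(n−1)/c⁴, and let (P_n^ν)_{n≥0} be the monic polynomials generated by the four-term recurrence with these coefficients. Then the raising–lowering relation holds: for every n ≥ 1, the derivative of P_n^ν equals n · P_{n−1}^{ν+1}, i.e. (P_n^ν)′(x) = n·P_{n−1}^{ν+1}(x) for all x. -/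
open Polynomial

/-- The four-term recurrence with the coefficients `b_n`, `c_n`, `d_n` written as polynomials
in `a = 1/c`. -/
def BesselRec {A : Type*} [CommRing A] (x a v : A) (p : ℕ → A) : Prop :=
  ∀ n : ℕ, p (n + 1) = (x - (a ^ 2 + a * (v + 2 * n + 1))) * p n
    - (n * (2 * a ^ 3 + a ^ 2 * (v + n))) * p (n - 1)
    - (n * (n - 1) * a ^ 4) * p (n - 2)

/-- Consecutive parameters are connected by `P_n^ν = P_n^{ν+1} + (n/c) P_{n-1}^{ν+1}`. -/
theorem BesselRec.connection {A : Type*} [CommRing A] {x a v : A} {p q : ℕ → A}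
    (hp : BesselRec x a v p) (hq : BesselRec x a (v + 1) q) (h0 : p 0 = q 0) (n : ℕ) :
    p n = q n + n * a * q (n - 1) := by
  induction n using Nat.strong_induction_on with
  | _ n ih =>
    match n with
    | 0 => simp [h0]
    | 1 =>
      have h1 := hp 0
      have h2 := hq 0
      simp only [Nat.cast_zero, Nat.cast_one, zero_add, Nat.sub_self, Nat.zero_sub] at *
      linear_combination h1 - h2 + (x - (a ^ 2 + a * (v + 1))) * h0
    | 2 =>
      have h1 := hp 1
      have h2 := hq 1
      have h3 := hq 0
      have i1 := ih 1 (by norm_num)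
      norm_num at *
      linear_combination h1 - h2 + (x - (a ^ 2 + a * (v + 2 + 1))) * i1 - a * h3
        - (2 * a ^ 3 + a ^ 2 * (v + 1)) * h0
    | 3 =>
      have h1 := hp 2
      have h2 := hq 2
      have h3 := hq 1
      have i2 := ih 2 (by norm_num)
      have i1 := ih 1 (by norm_num)
      norm_num at *
      linear_combination h1 - h2 + (x - (a ^ 2 + a * (v + 2 * 2 + 1))) * i2 - 2 * a * h3
        - (2 * (2 * a ^ 3 + a ^ 2 * (v + 2))) * i1 - 2 * (2 - 1) * a ^ 4 * h0
    | k + 4 =>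
      have h1 := hp (k + 3)
      have h2 := hq (k + 3)
      have h3 := hq (k + 2)
      have i3 := ih (k + 3) (by lia)
      have i2 := ih (k + 2) (by lia)
      have i1 := ih (k + 1) (by lia)
      simp only [Nat.add_assoc, Nat.reduceAdd, Nat.add_sub_cancel, Nat.reduceSubDiff] at h1 h2 h3 i1 i2 i3 ⊢
      push_cast at h1 h2 h3 i1 i2 i3 ⊢
      linear_combination h1 - h2 + (x - (a ^ 2 + a * (v + 2 * (k + 3) + 1))) * i3
        - (k + 3) * a * h3 - ((k + 3) * (2 * a ^ 3 + a ^ 2 * (v + (k + 3)))) * i2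
        - (k + 3) * (k + 3 - 1) * a ^ 4 * i1

/-- A derivation `D` with `D x = 1` that kills the constants `a` and `v` lowers the degree and
raises the parameter of solutions of the recurrence. -/
theorem BesselRec.derivation {R A : Type*} [CommRing R] [CommRing A] [Algebra R A]
    (D : Derivation R A A) {x a v : A} {p q : ℕ → A} (hx : D x = 1) (ha : D a = 0)
    (hv : D v = 0) (hp : BesselRec x a v p) (hq : BesselRec x a (v + 1) q)
    (hp0 : p 0 = 1) (hq0 : q 0 = 1) (n : ℕ) :
    D (p n) = n * q (n - 1) := by
  have hconn := hp.connection hq (hp0.trans hq0.symm)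
  have hDp0 : D (p 0) = 0 := by rw [hp0, D.map_one_eq_zero]
  have hD (n : ℕ) : D (p (n + 1)) = p n + (x - (a ^ 2 + a * (v + 2 * n + 1))) * D (p n)
      - (n * (2 * a ^ 3 + a ^ 2 * (v + n))) * D (p (n - 1))
      - (n * (n - 1) * a ^ 4) * D (p (n - 2)) := by
    have h2 : D (2 : A) = 0 := D.map_natCast 2
    rw [hp n]
    simp only [map_sub, map_add, Derivation.leibniz, Derivation.leibniz_pow, hx, ha, hv, h2,
      Derivation.map_natCast, Derivation.map_one_eq_zero, smul_eq_mul, smul_zero, mul_zero,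
      add_zero, sub_zero]
    ring
  induction n using Nat.strong_induction_on with
  | _ n ih =>
    match n with
    | 0 => simp [hDp0]
    | 1 =>
      have h1 := hD 0
      simpa [hDp0, hp0, hq0] using h1
    | 2 =>
      have h1 := hD 1
      have h2 := hq 0
      have i1 := ih 1 (by norm_num)
      have e := hconn 1
      norm_num at h1 h2 i1 e ⊢
      linear_combination h1 - h2 + (x - (a ^ 2 + a * (v + 2 + 1))) * i1
        - (2 * a ^ 3 + a ^ 2 * (v + 1)) * hDp0 + e
    | 3 =>
      have h1 := hD 2
      have h2 := hq 1
      have i2 := ih 2 (by norm_num)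
      have i1 := ih 1 (by norm_num)
      have e := hconn 2
      norm_num at h1 h2 i1 i2 e ⊢
      linear_combination h1 - 2 * h2 + (x - (a ^ 2 + a * (v + 2 * 2 + 1))) * i2
        - (2 * (2 * a ^ 3 + a ^ 2 * (v + 2))) * i1 - 2 * (2 - 1) * a ^ 4 * hDp0 + e
    | k + 4 =>
      have h1 := hD (k + 3)
      have h2 := hq (k + 2)
      have i3 := ih (k + 3) (by lia)
      have i2 := ih (k + 2) (by lia)
      have i1 := ih (k + 1) (by lia)
      have e := hconn (k + 3)
      simp only [Nat.add_assoc, Nat.reduceAdd, Nat.add_sub_cancel, Nat.reduceSubDiff] at h1 h2 i1 i2 i3 e ⊢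
      push_cast at h1 h2 i1 i2 i3 e ⊢
      linear_combination h1 - (k + 3) * h2 + (x - (a ^ 2 + a * (v + 2 * (k + 3) + 1))) * i3
        - ((k + 3) * (2 * a ^ 3 + a ^ 2 * (v + (k + 3)))) * i2
        - (k + 3) * (k + 3 - 1) * a ^ 4 * i1 + e

/-- Raising–lowering property for the type II multiple orthogonal polynomials on the
stepline associated with the Bessel `I_ν` weights: the monic polynomials `P_n^ν` generated
by the four-term recurrence with `b_n = (1+c(ν+2n+1))/c²`, `c_n = n(2+c(ν+n))/c³`,
`d_n = n(n-1)/c⁴` satisfy `(P_n^ν)′ = n·P_{n-1}^{ν+1}` for `n ≥ 1`. -/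
theorem bessel_I_raising_lowering
    (c : ℝ) (hc : 0 < c)
    (P : ℝ → ℕ → Polynomial ℝ)
    (hP0 : ∀ ν : ℝ, -1 < ν → P ν 0 = 1)
    (hrec : ∀ ν : ℝ, -1 < ν → ∀ n : ℕ,
      P ν (n + 1) = (X - C ((1 + c * (ν + 2 * (n : ℝ) + 1)) / c ^ 2)) * P ν n
        - C ((n : ℝ) * (2 + c * (ν + (n : ℝ))) / c ^ 3) * P ν (n - 1)
        - C ((n : ℝ) * ((n : ℝ) - 1) / c ^ 4) * P ν (n - 2)) :
    ∀ ν : ℝ, -1 < ν → ∀ n : ℕ, 1 ≤ n →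
      Polynomial.derivative (P ν n) = C (n : ℝ) * P (ν + 1) (n - 1) := by
  have hrec' (ν : ℝ) (hν : -1 < ν) : BesselRec X (C c⁻¹) (C ν) (P ν) := by
    intro n
    have hb : (1 + c * (ν + 2 * (n : ℝ) + 1)) / c ^ 2
        = c⁻¹ ^ 2 + c⁻¹ * (ν + 2 * n + 1) := by field_simp
    have hc' : (n : ℝ) * (2 + c * (ν + (n : ℝ))) / c ^ 3
        = n * (2 * c⁻¹ ^ 3 + c⁻¹ ^ 2 * (ν + n)) := by field_simp
    have hd : (n : ℝ) * ((n : ℝ) - 1) / c ^ 4 = n * (n - 1) * c⁻¹ ^ 4 := by field_simp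
    have h := hrec ν hν n
    rw [hb, hc', hd] at h
    simpa only [map_add, map_sub, map_mul, map_pow, map_natCast, map_one, map_ofNat] using h
  intro ν hν n _
  have hν' : -1 < ν + 1 := by linarith
  have hq : BesselRec X (C c⁻¹) (C ν + 1) (P (ν + 1)) := by
    simpa only [map_add, map_one] using hrec' (ν + 1) hν'
  simpa using (hrec' ν hν).derivation Polynomial.derivative' (by simp) (by simp) (by simp) hq
    (hP0 ν hν) (hP0 _ hν') n
end

section
/- Let ν > −1 and c > 0, let ω_{ν,c}(x) = e^{−cx} · Σ_{k=0}^∞ x^{ν+k}/(k!·Γ(ν+k+1)) for x > 0, and let (P_n)_{n≥0} be the monic polynomials generated by the four-term recurrence with coefficients b_n = (1 + c(ν+2n+1))/c², c_n = n(2 + c(ν+n))/c³, d_n = n(n−1)/c⁴. Then P_n is the type II multiple orthogonal polynomial on the stepline for the weights (ω_{ν,c}, ω_{ν+1,c}); that is, for every n ≥ 0: ∫_0^∞ P_{2n}(x)·x^k·ω_{ν,c}(x) dx = 0 and ∫_0^∞ P_{2n}(x)·x^k·ω_{ν+1,c}(x) dx = 0 for 0 ≤ k ≤ n−1, and ∫_0^∞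 P_{2n+1}(x)·x^k·ω_{ν,c}(x) dx = 0 for 0 ≤ k ≤ n while ∫_0^∞ P_{2n+1}(x)·x^k·ω_{ν+1,c}(x) dx = 0 for 0 ≤ k ≤ n−1. -/
open MeasureTheory Polynomial

/-- The `k`-th term of the series of `x ^ (s / 2) * I_s (2 * √x)`. -/
noncomputable def besselITerm (s x : ℝ) (k : ℕ) : ℝ :=
  x ^ (s + k) / (k.factorial * Real.Gamma (s + k + 1))

/-- The modified Bessel weight `x ^ (s / 2) * I_s (2 * √x) * exp (-c * x)`. -/
noncomputable def besselIWeight (c s x : ℝ) : ℝ :=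
  Real.exp (-c * x) * ∑' k : ℕ, besselITerm s x k

lemma besselITerm_succ {s x : ℝ} (hs : -1 < s) (hx : 0 < x) (k : ℕ) :
    besselITerm s x (k + 1) = x / ((k + 1) * (s + k + 1)) * besselITerm s x k := by
  have hk : (0 : ℝ) ≤ k := k.cast_nonneg
  have h : 0 < s + k + 1 := by linarith
  have hG := (Real.Gamma_pos_of_pos h).ne'
  have hf : (k.factorial : ℝ) ≠ 0 := by exact_mod_cast k.factorial_ne_zero
  unfold besselITerm
  rw [Nat.factorial_succ]
  push_cast
  rw [← add_assoc, Real.rpow_add_one hx.ne', Real.Gamma_add_one h.ne']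
  field_simp

lemma summable_besselITerm {s x : ℝ} (hs : -1 < s) (hx : 0 < x) :
    Summable (besselITerm s x) := by
  refine summable_of_ratio_norm_eventually_le (r := 1 / 2) (by norm_num) ?_
  filter_upwards [Filter.eventually_ge_atTop (⌈2 * x⌉₊)] with k hk
  have hk' : 2 * x ≤ k := Nat.ceil_le.mp hk
  have h : 0 < s + k + 1 := by linarith
  rw [besselITerm_succ hs hx, norm_mul]
  refine mul_le_mul_of_nonneg_right ?_ (norm_nonneg _)
  rw [Real.norm_of_nonneg (by positivity), div_le_div_iff₀ (by positivity) two_pos]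
  nlinarith [mul_nonneg (hx.le.trans (by linarith : x ≤ (k : ℝ))) (by linarith : 0 ≤ s + 1), h]

lemma mul_tsum_besselITerm {s x : ℝ} (hs : -1 < s) (hx : 0 < x) :
    x * ∑' k, besselITerm s x k =
      ∑' k, besselITerm (s + 2) x k + (s + 1) * ∑' k, besselITerm (s + 1) x k := by
  have h₁ : Summable (besselITerm (s + 1) x) := summable_besselITerm (by linarith) hx
  have hshift : ∀ k : ℕ, besselITerm (s + 2) x k = (k + 1 : ℕ) * besselITerm (s + 1) x (k + 1) := by
    intro k
    have hf : (k.factorial : ℝ) ≠ 0 := by exact_mod_cast k.factorial_ne_zero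
    unfold besselITerm
    rw [Nat.factorial_succ]
    push_cast
    rw [show s + 1 + ((k : ℝ) + 1) = s + 2 + k by ring]
    field_simp
  have h₂ : HasSum (fun k : ℕ => k * besselITerm (s + 1) x k) (∑' k, besselITerm (s + 2) x k) := by
    rw [← hasSum_nat_add_iff' 1]
    simp only [Finset.sum_range_one, Nat.cast_zero, zero_mul, sub_zero, ← hshift]
    exact (summable_besselITerm (by linarith) hx).hasSum
  rw [← tsum_mul_left, ← (h₂.add (h₁.hasSum.mul_left (s + 1))).tsum_eq]
  refine tsum_congr fun k => ?_
  have hk : (0 : ℝ) ≤ k := k.cast_nonneg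
  have h : 0 < s + k + 1 := by linarith
  have hG := (Real.Gamma_pos_of_pos h).ne'
  have hf : (k.factorial : ℝ) ≠ 0 := by exact_mod_cast k.factorial_ne_zero
  unfold besselITerm
  rw [show s + 1 + (k : ℝ) = s + k + 1 by ring, Real.rpow_add_one hx.ne',
    Real.Gamma_add_one h.ne']
  field_simp
  ring

lemma mul_besselIWeight (c : ℝ) {s x : ℝ} (hs : -1 < s) (hx : 0 < x) :
    x * besselIWeight c s x =
      besselIWeight c (s + 2) x + (s + 1) * besselIWeight c (s + 1) x := by
  unfold besselIWeight
  linear_combination Real.exp (-c * x) * mul_tsum_besselITerm hs hx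

lemma integral_exp_mul_besselITerm {c s : ℝ} (hs : -1 < s) (hc : 0 < c) (k : ℕ) :
    ∫ x in Set.Ioi (0 : ℝ), Real.exp (-c * x) * besselITerm s x k =
      (1 / c) ^ (s + 1) * ((1 / c) ^ k / k.factorial) := by
  have hk : (0 : ℝ) ≤ k := k.cast_nonneg
  have h : 0 < s + k + 1 := by linarith
  have hG := (Real.Gamma_pos_of_pos h).ne'
  have hf : (k.factorial : ℝ) ≠ 0 := by exact_mod_cast k.factorial_ne_zero
  have hint := Real.integral_rpow_mul_exp_neg_mul_Ioi h hc
  calc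
    _ = ∫ x in Set.Ioi (0 : ℝ), (k.factorial * Real.Gamma (s + k + 1))⁻¹ *
          (x ^ (s + k + 1 - 1) * Real.exp (-(c * x))) := by
      congr 1 with x
      rw [besselITerm, add_sub_cancel_right, neg_mul]
      ring
    _ = _ := by
      rw [integral_const_mul, hint]
      rw [mul_inv, mul_assoc, mul_comm (Real.Gamma _)⁻¹, mul_assoc, mul_inv_cancel₀ hG, mul_one,
        show s + k + 1 = s + 1 + (k : ℝ) by ring, Real.rpow_add (by positivity), Real.rpow_natCast]
      field_simp

lemma integral_besselIWeight {c s : ℝ} (hs : -1 < s) (hc : 0 < c) :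
    ∫ x in Set.Ioi (0 : ℝ), besselIWeight c s x = (1 / c) ^ (s + 1) * Real.exp (1 / c) := by
  have hexp : HasSum (fun k : ℕ => (1 / c) ^ (s + 1) * ((1 / c) ^ k / k.factorial))
      ((1 / c) ^ (s + 1) * Real.exp (1 / c)) := by
    rw [Real.exp_eq_exp_ℝ]
    exact (NormedSpace.expSeries_div_hasSum_exp (1 / c)).mul_left _
  have hnorm (k : ℕ) : ∫ x in Set.Ioi (0 : ℝ), ‖Real.exp (-c * x) * besselITerm s x k‖ =
      (1 / c) ^ (s + 1) * ((1 / c) ^ k / k.factorial) := by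
    rw [← integral_exp_mul_besselITerm hs hc]
    refine setIntegral_congr_fun measurableSet_Ioi fun x (hx : 0 < x) => ?_
    have hG : 0 < Real.Gamma (s + k + 1) :=
      Real.Gamma_pos_of_pos (by linarith [(Nat.cast_nonneg k : (0 : ℝ) ≤ k)])
    refine Real.norm_of_nonneg ?_
    unfold besselITerm
    positivity
  have hintegrable (k : ℕ) : Integrable (fun x => Real.exp (-c * x) * besselITerm s x k)
      (volume.restrict (Set.Ioi 0)) :=
    .of_integral_ne_zero (by rw [integral_exp_mul_besselITerm hs hc]; positivity)
  have hsum := hasSum_integral_of_summable_integral_norm hintegrable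
    (by simpa only [hnorm] using hexp.summable)
  simp only [integral_exp_mul_besselITerm hs hc, tsum_mul_left] at hsum
  exact hsum.unique hexp

lemma integrableOn_pow_mul_besselIWeight {c : ℝ} (hc : 0 < c) (m : ℕ) {s : ℝ} (hs : -1 < s) :
    IntegrableOn (fun x => x ^ m * besselIWeight c s x) (Set.Ioi 0) := by
  induction m generalizing s with
  | zero =>
    simp only [pow_zero, one_mul]
    exact .of_integral_ne_zero (by rw [integral_besselIWeight hs hc]; positivity)
  | succ m ih =>
    refine ((ih (s := s + 2) (by linarith)).add
      ((ih (s := s + 1) (by linarith)).const_mul (s + 1))).congr_fun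
      (fun x (hx : 0 < x) => ?_) measurableSet_Ioi
    simp only [Pi.add_apply]
    linear_combination -x ^ m * mul_besselIWeight c hs hx

lemma integrableOn_eval_mul_besselIWeight {c s : ℝ} (hc : 0 < c) (hs : -1 < s) (p : ℝ[X]) :
    IntegrableOn (fun x => p.eval x * besselIWeight c s x) (Set.Ioi 0) := by
  simp only [eval_eq_sum_range, Finset.sum_mul, mul_assoc]
  exact integrable_finsetSum _ fun m _ =>
    (integrableOn_pow_mul_besselIWeight hc m hs).const_mul _

/-- The linear functional on polynomials given by integration against the Bessel weight. -/
noncomputable def besselIMoment (c s : ℝ) (p : ℝ[X]) : ℝ :=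
  ∫ x in Set.Ioi (0 : ℝ), p.eval x * besselIWeight c s x

lemma besselIMoment_one {c s : ℝ} (hc : 0 < c) (hs : -1 < s) :
    besselIMoment c s 1 = (1 / c) ^ (s + 1) * Real.exp (1 / c) := by
  simp only [besselIMoment, eval_one, one_mul, integral_besselIWeight hs hc]

lemma besselIMoment_sub {c s : ℝ} (hc : 0 < c) (hs : -1 < s) (p q : ℝ[X]) :
    besselIMoment c s (p - q) = besselIMoment c s p - besselIMoment c s q := by
  simp only [besselIMoment, eval_sub, sub_mul]
  exact integral_sub (integrableOn_eval_mul_besselIWeight hc hs p)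
    (integrableOn_eval_mul_besselIWeight hc hs q)

lemma besselIMoment_C_mul (c s a : ℝ) (p : ℝ[X]) :
    besselIMoment c s (C a * p) = a * besselIMoment c s p := by
  simp only [besselIMoment, eval_mul, eval_C, mul_assoc, integral_const_mul]

lemma besselIMoment_X_mul {c s : ℝ} (hc : 0 < c) (hs : -1 < s) (p : ℝ[X]) :
    besselIMoment c s (X * p) =
      besselIMoment c (s + 2) p + (s + 1) * besselIMoment c (s + 1) p := by
  unfold besselIMoment
  rw [← integral_const_mul, ← integral_add
    (integrableOn_eval_mul_besselIWeight hc (by linarith) p)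
    ((integrableOn_eval_mul_besselIWeight hc (by linarith) p).const_mul _)]
  refine setIntegral_congr_fun measurableSet_Ioi fun x (hx : 0 < x) => ?_
  simp only [eval_mul, eval_X]
  linear_combination p.eval x * mul_besselIWeight c hs hx

lemma besselIMoment_X_pow_mul_eq_zero {c : ℝ} (hc : 0 < c) (p : ℝ[X]) (k : ℕ) {s : ℝ}
    (hs : -1 < s) (h : ∀ j : ℕ, j ≤ 2 * k → besselIMoment c (s + j) p = 0) :
    besselIMoment c s (X ^ k * p) = 0 := by
  induction k generalizing s with
  | zero => simpa using h 0 le_rfl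
  | succ k ih =>
    rw [pow_succ', mul_assoc, besselIMoment_X_mul hc hs, ih (by linarith), ih (by linarith)]
    · simp
    · intro j hj
      rw [add_assoc, add_comm 1 (j : ℝ)]
      exact_mod_cast h (j + 1) (by omega)
    · intro j hj
      rw [add_assoc, add_comm 2 (j : ℝ)]
      exact_mod_cast h (j + 2) (by omega)

lemma cast_descFactorial_succ (j m : ℕ) :
    (j.descFactorial (m + 1) : ℝ) = (j - m) * j.descFactorial m := by
  rw [Nat.descFactorial_succ]
  rcases le_or_gt m j with h | h
  · push_cast [h]
    ring
  · simp [Nat.descFactorial_eq_zero_iff_lt.mpr h]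

lemma besselIMoment_stepline {ν c : ℝ} (hν : -1 < ν) (hc : 0 < c)
    {P : ℕ → ℝ[X]} (hP0 : P 0 = 1)
    (hrec : ∀ n : ℕ,
      P (n + 1) = (X - C ((1 + c * (ν + 2 * (n : ℝ) + 1)) / c ^ 2)) * P n
        - C ((n : ℝ) * (2 + c * (ν + (n : ℝ))) / c ^ 3) * P (n - 1)
        - C ((n : ℝ) * ((n : ℝ) - 1) / c ^ 4) * P (n - 2)) (n j : ℕ) :
    besselIMoment c (ν + j) (P n) =
      (1 / c) ^ (ν + 1) * Real.exp (1 / c) * j.descFactorial n / c ^ (j + n) := by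
  have hs (j : ℕ) : -1 < ν + j := by linarith [(Nat.cast_nonneg j : (0 : ℝ) ≤ j)]
  have hstep (n j : ℕ) : besselIMoment c (ν + j) (P (n + 1)) =
      besselIMoment c (ν + (j + 2 : ℕ)) (P n)
        + (ν + j + 1) * besselIMoment c (ν + (j + 1 : ℕ)) (P n)
        - (1 + c * (ν + 2 * (n : ℝ) + 1)) / c ^ 2 * besselIMoment c (ν + j) (P n)
        - (n : ℝ) * (2 + c * (ν + (n : ℝ))) / c ^ 3 * besselIMoment c (ν + j) (P (n - 1))
        - (n : ℝ) * ((n : ℝ) - 1) / c ^ 4 * besselIMoment c (ν + j) (P (n - 2)) := by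
    rw [hrec n, sub_mul]
    simp only [besselIMoment_sub hc (hs j), besselIMoment_C_mul, besselIMoment_X_mul hc (hs j)]
    push_cast
    simp only [add_assoc]
  induction n using Nat.strong_induction_on generalizing j with
  | _ n ih =>
    match n, ih with
    | 0, _ =>
      rw [hP0, besselIMoment_one hc (hs j), show ν + j + 1 = ν + 1 + (j : ℝ) by ring,
        Real.rpow_add (by positivity), Real.rpow_natCast]
      simp
      field_simp
    | 1, ih =>
      simp only [hstep 0, ih 0 one_pos, Nat.descFactorial_zero, Nat.descFactorial_one]
      push_cast
      field_simp
      ring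
    | 2, ih =>
      simp only [hstep 1, ih 0 two_pos, ih 1 one_lt_two, Nat.sub_self, Nat.descFactorial_zero,
        Nat.descFactorial_one, cast_descFactorial_succ j 1]
      push_cast
      field_simp
      ring
    | n + 3, ih =>
      simp only [hstep (n + 2), ih (n + 2) (by omega),
        show n + 2 - 1 = n + 1 by omega, ih (n + 1) (by omega),
        show n + 2 - 2 = n by omega, ih n (by omega),
        Nat.succ_descFactorial_succ, Nat.cast_mul, cast_descFactorial_succ]
      push_cast
      field_simp
      ring

lemma besselIMoment_stepline_eq_zero {ν c : ℝ} (hν : -1 < ν) (hc : 0 < c)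
    {P : ℕ → ℝ[X]} (hP0 : P 0 = 1)
    (hrec : ∀ n : ℕ,
      P (n + 1) = (X - C ((1 + c * (ν + 2 * (n : ℝ) + 1)) / c ^ 2)) * P n
        - C ((n : ℝ) * (2 + c * (ν + (n : ℝ))) / c ^ 3) * P (n - 1)
        - C ((n : ℝ) * ((n : ℝ) - 1) / c ^ 4) * P (n - 2)) {n k i : ℕ} (h : 2 * k + i < n) :
    besselIMoment c (ν + i) (X ^ k * P n) = 0 := by
  refine besselIMoment_X_pow_mul_eq_zero hc _ k
    (by linarith [(Nat.cast_nonneg i : (0 : ℝ) ≤ i)]) fun j hj => ?_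
  rw [add_assoc, ← Nat.cast_add, besselIMoment_stepline hν hc hP0 hrec,
    Nat.descFactorial_eq_zero_iff_lt.mpr (by omega)]
  simp

/-- The monic polynomials generated by the four-term recurrence with
`b_n = (1+c(ν+2n+1))/c²`, `c_n = n(2+c(ν+n))/c³`, `d_n = n(n-1)/c⁴` are the type II
multiple orthogonal polynomials on the stepline for the Bessel weights
`(ω_{ν,c}, ω_{ν+1,c})` on `(0,∞)`. -/
theorem bessel_I_stepline_orthogonality
    (ν c : ℝ) (hν : -1 < ν) (hc : 0 < c)
    (ω : ℝ → ℝ → ℝ)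
    (hω : ∀ s x : ℝ, 0 < x →
      ω s x = Real.exp (-c * x) *
        ∑' k : ℕ, x ^ (s + k) / (k.factorial * Real.Gamma (s + k + 1)))
    (P : ℕ → Polynomial ℝ) (hP0 : P 0 = 1)
    (hrec : ∀ n : ℕ,
      P (n + 1) = (X - C ((1 + c * (ν + 2 * (n : ℝ) + 1)) / c ^ 2)) * P n
        - C ((n : ℝ) * (2 + c * (ν + (n : ℝ))) / c ^ 3) * P (n - 1)
        - C ((n : ℝ) * ((n : ℝ) - 1) / c ^ 4) * P (n - 2)) :
    ∀ n : ℕ,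
      (∀ k < n, ∫ x in Set.Ioi (0 : ℝ), (P (2 * n)).eval x * x ^ k * ω ν x = 0) ∧
      (∀ k < n, ∫ x in Set.Ioi (0 : ℝ), (P (2 * n)).eval x * x ^ k * ω (ν + 1) x = 0) ∧
      (∀ k ≤ n, ∫ x in Set.Ioi (0 : ℝ), (P (2 * n + 1)).eval x * x ^ k * ω ν x = 0) ∧
      (∀ k < n, ∫ x in Set.Ioi (0 : ℝ), (P (2 * n + 1)).eval x * x ^ k * ω (ν + 1) x = 0) := by
  have hmoment (s : ℝ) (p : ℝ[X]) (k : ℕ) :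
      ∫ x in Set.Ioi (0 : ℝ), p.eval x * x ^ k * ω s x = besselIMoment c s (X ^ k * p) := by
    refine setIntegral_congr_fun measurableSet_Ioi fun x (hx : 0 < x) => ?_
    simp only [hω s x hx, besselIWeight, besselITerm, eval_mul, eval_pow, eval_X]
    ring
  have hzero {n k : ℕ} (h : 2 * k < n) : besselIMoment c ν (X ^ k * P n) = 0 := by
    simpa using besselIMoment_stepline_eq_zero hν hc hP0 hrec (i := 0) h
  have hone {n k : ℕ} (h : 2 * k + 1 < n) : besselIMoment c (ν + 1) (X ^ k * P n) = 0 := by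
    simpa using besselIMoment_stepline_eq_zero hν hc hP0 hrec (i := 1) h
  intro n
  simp only [hmoment]
  exact ⟨fun k hk => hzero (by omega), fun k hk => hone (by omega),
    fun k hk => hzero (by omega), fun k hk => hone (by omega)⟩
end

section
/- Let ν ≥ 0 and α > −1 be real numbers, let ρ_ν(x) = x^ν · ∫_0^∞ exp(−t − x/t)·t^{−ν−1} dt for x > 0, and let (P_n)_{n≥0} be the monic polynomials generated by the four-term recurrence with coefficients b_n = (n+α+1)(3n+α+2ν) − (α+1)(ν−1), c_n = n(n+α)(n+α+ν)(3n+2α+ν), d_n = n(n−1)(n+α)(n+α−1)(n+α+ν)(n+α+ν−1). Then P_n is the type II multiple orthogonal polynomial on the stepline for the weights (x^α ρ_ν, x^α ρ_{ν+1}); that is, for every n ≥ 0: ∫_0^∞ P_{2n}(x)·x^k·x^α·ρ_ν(x) dx = 0 and ∫_0^∞ P_{2n}(x)·x^k·x^α·ρ_{ν+1}(x) dx = 0 for 0 ≤ k ≤ n−1, and ∫_0^∞ P_{2n+1}(x)·x^k·x^α·ρ_ν(x) dx = 0 for 0 ≤ k ≤ n while ∫_0^∞ P_{2n+1}(x)·x^k·x^α·ρ_{ν+1}(x)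 dx = 0 for 0 ≤ k ≤ n−1. -/
open MeasureTheory Polynomial

/-- The signed product of Gamma values whose ratios give the coefficients of the polynomials. -/
noncomputable def signedGammaProd (a b : ℝ) (n : ℕ) : ℝ :=
  (-1) ^ n * (Real.Gamma (a + n) * Real.Gamma (b + n))

theorem signedGammaProd_ne_zero {a b : ℝ} (ha : 0 < a) (hb : 0 < b) (n : ℕ) :
    signedGammaProd a b n ≠ 0 := by
  have h1 : 0 < Real.Gamma (a + n) := Real.Gamma_pos_of_pos (by positivity)
  have h2 : 0 < Real.Gamma (b + n) := Real.Gamma_pos_of_pos (by positivity)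
  unfold signedGammaProd
  simp [h1.ne', h2.ne']

theorem signedGammaProd_succ {a b : ℝ} (ha : 0 < a) (hb : 0 < b) (n : ℕ) :
    signedGammaProd a b (n + 1) = -((a + n) * (b + n)) * signedGammaProd a b n := by
  unfold signedGammaProd
  push_cast
  rw [← add_assoc, ← add_assoc, Real.Gamma_add_one (by positivity),
    Real.Gamma_add_one (by positivity)]
  ring

/-- The `j`-th coefficient of the `n`-th monic polynomial proportional to
`₁F₂(-n; a, b; x)`. -/
noncomputable def hypergeometricCoeff (a b : ℝ) (n j : ℕ) : ℝ :=
  n.choose j * signedGammaProd a b n / signedGammaProd a b j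

theorem natCast_choose_mul_succ (n j : ℕ) :
    (n.choose j : ℝ) * (n + 1) = (n + 1).choose j * (n + 1 - j) := by
  rcases le_or_gt j (n + 1) with h | h
  · have := congrArg (Nat.cast (R := ℝ)) (Nat.choose_mul_succ_eq n j)
    push_cast [Nat.cast_sub h] at this
    exact this
  · simp [Nat.choose_eq_zero_of_lt h, Nat.choose_eq_zero_of_lt (show n < j by omega)]

theorem natCast_choose_succ_right (n j : ℕ) :
    (n.choose (j + 1) : ℝ) * (j + 1) = n.choose j * (n - j) := by
  rcases le_or_gt j n with h | h
  · have := congrArg (Nat.cast (R := ℝ)) (Nat.choose_succ_right_eq n j)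
    push_cast [Nat.cast_sub h] at this
    exact this
  · simp [Nat.choose_eq_zero_of_lt h, Nat.choose_eq_zero_of_lt (show n < j + 1 by omega)]

section Coefficients

variable {a b : ℝ}

theorem hypergeometricCoeff_pred (ha : 0 < a) (hb : 0 < b) (n j : ℕ) :
    (n : ℝ) * (n + a - 1) * (n + b - 1) * hypergeometricCoeff a b (n - 1) j
      = -(n - j) * hypergeometricCoeff a b n j := by
  unfold hypergeometricCoeff
  rcases n with _ | m
  · rcases j with _ | j <;> simp
  · have h := natCast_choose_mul_succ m j
    simp only [Nat.add_sub_cancel]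
    rw [signedGammaProd_succ ha hb m]
    push_cast
    linear_combination ((a + m) * (b + m) * signedGammaProd a b m / signedGammaProd a b j) * h

theorem hypergeometricCoeff_pred_pred (ha : 0 < a) (hb : 0 < b) (n j : ℕ) :
    (n : ℝ) * (n - 1) * (n + a - 1) * (n + a - 2) * (n + b - 1) * (n + b - 2)
        * hypergeometricCoeff a b (n - 2) j
      = (n - j) * (n - 1 - j) * hypergeometricCoeff a b n j := by
  rcases n with _ | m
  · rcases j with _ | j <;> simp [hypergeometricCoeff]
  · have h1 := hypergeometricCoeff_pred ha hb (m + 1) j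
    have h2 := hypergeometricCoeff_pred ha hb m j
    have e : m + 1 - 2 = m - 1 := by omega
    rw [e]
    simp only [Nat.add_sub_cancel] at h1
    push_cast at h1 ⊢
    linear_combination (m + 1 : ℝ) * (m + a) * (m + b) * h2 - (m - j : ℝ) * h1

theorem hypergeometricCoeff_succ_right (ha : 0 < a) (hb : 0 < b) (n j : ℕ) :
    (j + 1 : ℝ) * (a + j) * (b + j) * hypergeometricCoeff a b n (j + 1)
      = -(n - j) * hypergeometricCoeff a b n j := by
  have h := natCast_choose_succ_right n j
  have h0 := signedGammaProd_ne_zero ha hb j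
  have h1 : a + j ≠ 0 := by positivity
  have h2 : b + j ≠ 0 := by positivity
  unfold hypergeometricCoeff
  rw [signedGammaProd_succ ha hb j]
  field_simp
  linear_combination (-signedGammaProd a b n) * h

theorem hypergeometricCoeff_succ_succ (ha : 0 < a) (hb : 0 < b) (n j : ℕ) :
    (j + 1 : ℝ) * (a + j) * (b + j) * hypergeometricCoeff a b (n + 1) (j + 1)
      = (n + 1) * (a + n) * (b + n) * hypergeometricCoeff a b n j := by
  have h := congrArg (Nat.cast (R := ℝ)) (Nat.add_one_mul_choose_eq n j)
  push_cast at h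
  have h0 := signedGammaProd_ne_zero ha hb j
  have h1 : a + j ≠ 0 := by positivity
  have h2 : b + j ≠ 0 := by positivity
  unfold hypergeometricCoeff
  rw [signedGammaProd_succ ha hb j, signedGammaProd_succ ha hb n]
  field_simp
  linear_combination (-signedGammaProd a b n) * h

theorem hypergeometricCoeff_succ_zero (ha : 0 < a) (hb : 0 < b) (n : ℕ) :
    hypergeometricCoeff a b (n + 1) 0
      = -((a + n) * (b + n)) * hypergeometricCoeff a b n 0 := by
  unfold hypergeometricCoeff
  rw [signedGammaProd_succ ha hb n]
  simp only [Nat.choose_zero_right]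
  ring

end Coefficients

theorem coeff_eq_hypergeometricCoeff {ν α : ℝ} (hν : 0 ≤ ν) (hα : -1 < α)
    (P : ℕ → Polynomial ℝ) (hP0 : P 0 = 1)
    (hrec : ∀ n : ℕ,
      P (n + 1) = (X - C (((n : ℝ) + α + 1) * (3 * (n : ℝ) + α + 2 * ν)
          - (α + 1) * (ν - 1))) * P n
        - C ((n : ℝ) * ((n : ℝ) + α) * ((n : ℝ) + α + ν) * (3 * (n : ℝ) + 2 * α + ν))
            * P (n - 1)
        - C ((n : ℝ) * ((n : ℝ) - 1) * ((n : ℝ) + α) * ((n : ℝ) + α - 1)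
            * ((n : ℝ) + α + ν) * ((n : ℝ) + α + ν - 1)) * P (n - 2))
    (n j : ℕ) : (P n).coeff j = hypergeometricCoeff (α + 1) (α + ν + 1) n j := by
  have ha : 0 < α + 1 := by linarith
  have hb : 0 < α + ν + 1 := by linarith
  induction n using Nat.strong_induction_on generalizing j with
  | _ n ih =>
    rcases n with _ | n
    · rw [hP0, coeff_one]
      rcases j with _ | j
      · simp [hypergeometricCoeff, signedGammaProd_ne_zero ha hb]
      · simp [hypergeometricCoeff]
    · rw [hrec n, coeff_sub, coeff_sub, sub_mul, coeff_sub, coeff_C_mul, coeff_C_mul, coeff_C_mul,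
        ih n (by omega), ih (n - 1) (by omega), ih (n - 2) (by omega)]
      have h1 := hypergeometricCoeff_pred ha hb n j
      have h2 := hypergeometricCoeff_pred_pred ha hb n j
      rcases j with _ | j
      · rw [coeff_X_mul_zero, hypergeometricCoeff_succ_zero ha hb]
        push_cast at h1 h2
        linear_combination -(3 * (n : ℝ) + 2 * α + ν) * h1 - h2
      · rw [coeff_X_mul, ih n (by omega)]
        have h3 := hypergeometricCoeff_succ_right ha hb n j
        have h4 := hypergeometricCoeff_succ_succ ha hb n j
        have hK : ((j : ℝ) + 1) * (α + 1 + j) * (α + ν + 1 + j) ≠ 0 := by positivity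
        push_cast at h1 h2
        apply mul_left_cancel₀ hK
        have h5 : ((n : ℝ) * (n + α) * (n + α + ν) * (3 * n + 2 * α + ν))
              * hypergeometricCoeff (α + 1) (α + ν + 1) (n - 1) (j + 1)
            = -(n - j - 1) * (3 * n + 2 * α + ν)
              * hypergeometricCoeff (α + 1) (α + ν + 1) n (j + 1) := by
          linear_combination (3 * (n : ℝ) + 2 * α + ν) * h1
        have h6 : ((n : ℝ) * (n - 1) * (n + α) * (n + α - 1) * (n + α + ν) * (n + α + ν - 1))
              * hypergeometricCoeff (α + 1) (α + ν + 1) (n - 2) (j + 1)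
            = (n - j - 1) * (n - 2 - j)
              * hypergeometricCoeff (α + 1) (α + ν + 1) n (j + 1) := by
          linear_combination h2
        rw [h5, h6, h4]
        linear_combination -(((n : ℝ) + α + 1) * (3 * n + α + 2 * ν) - (α + 1) * (ν - 1)
          - (n - j - 1) * (3 * n + 2 * α + ν) + (n - j - 1) * (n - 2 - j)) * h3

theorem Gamma_add_natCast_eq_ascPochhammer {x : ℝ} (hx : 0 < x) (k : ℕ) :
    Real.Gamma (x + k) = (ascPochhammer ℝ k).eval x * Real.Gamma x := by
  induction k with
  | zero => simp
  | succ k ih =>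
    push_cast
    rw [← add_assoc, Real.Gamma_add_one (by positivity), ih, ascPochhammer_succ_eval]
    ring

open Finset fwdDiff in
theorem sum_neg_one_pow_mul_choose_mul_eval_eq_zero {R : Type*} [CommRing R]
    (p : Polynomial R) {n : ℕ} (hp : p.natDegree < n) :
    ∑ j ∈ range (n + 1), (-1 : R) ^ (n - j) * n.choose j * p.eval (j : R) = 0 := by
  have h := congrFun (Polynomial.fwdDiff_iter_eq_zero_of_degree_lt hp) 0
  rw [fwdDiff_iter_eq_sum_shift] at h
  simpa using h

theorem sum_hypergeometricCoeff_mul_Gamma_eq_zero {a b : ℝ} (ha : 0 < a) (hb : 0 < b)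
    {n k m : ℕ} (h : k + m < n) :
    ∑ j ∈ Finset.range (n + 1), hypergeometricCoeff a b n j
      * (Real.Gamma (a + j + k) * Real.Gamma (b + j + m)) = 0 := by
  set p : Polynomial ℝ := (ascPochhammer ℝ k).comp (C a + X) * (ascPochhammer ℝ m).comp (C b + X)
    with hp
  have hdeg : p.natDegree < n := by
    have e : ∀ c : ℝ, (C c + X : Polynomial ℝ).natDegree = 1 := fun c => by
      rw [add_comm]; exact natDegree_X_add_C c
    refine lt_of_le_of_lt (natDegree_mul_le.trans ?_) h
    rw [natDegree_comp, natDegree_comp, ascPochhammer_natDegree, ascPochhammer_natDegree, e, e]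
    simp
  rw [← mul_zero ((-1) ^ n * signedGammaProd a b n),
    ← sum_neg_one_pow_mul_choose_mul_eval_eq_zero p hdeg, Finset.mul_sum]
  refine Finset.sum_congr rfl fun j hj => ?_
  have hj : j ≤ n := by simpa [Nat.lt_succ_iff] using hj
  have haj : 0 < a + j := by positivity
  have hbj : 0 < b + j := by positivity
  have hga := (Real.Gamma_pos_of_pos haj).ne'
  have hgb := (Real.Gamma_pos_of_pos hbj).ne'
  rw [Gamma_add_natCast_eq_ascPochhammer haj, Gamma_add_natCast_eq_ascPochhammer hbj]
  have hs : ((-1 : ℝ) ^ n * (-1) ^ (n - j)) * (-1) ^ j = 1 := by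
    rw [mul_assoc, ← pow_add, Nat.sub_add_cancel hj, ← mul_pow]; simp
  simp only [hypergeometricCoeff, hp, eval_mul, eval_comp, eval_add, eval_C, eval_X]
  rw [show signedGammaProd a b j = (-1) ^ j * (Real.Gamma (a + j) * Real.Gamma (b + j)) from rfl]
  field_simp
  linear_combination (-(n.choose j : ℝ) * signedGammaProd a b n
    * (ascPochhammer ℝ k).eval (a + j) * (ascPochhammer ℝ m).eval (b + j)) * hs

/-- The integrand of the double integral giving the `β`-th moment of `ρ_s`. -/
noncomputable def besselKernel (s β : ℝ) (z : ℝ × ℝ) : ℝ :=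
  z.1 ^ (β + s) * (Real.exp (-z.2 - z.1 / z.2) * z.2 ^ (-s - 1))

theorem besselKernel_eq {s β x t : ℝ} :
    besselKernel s β (x, t) = (Real.exp (-t) * t ^ (-s - 1))
      * (x ^ ((β + s + 1) - 1) * Real.exp (-(1 / t * x))) := by
  simp only [besselKernel, add_sub_cancel_right]
  rw [show -t - x / t = -t + -(1 / t * x) by ring, Real.exp_add]
  ring

theorem integral_besselKernel_fst {s β t : ℝ} (hs : 0 < β + s + 1) (ht : 0 < t) :
    ∫ x in Set.Ioi (0 : ℝ), besselKernel s β (x, t)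
      = Real.Gamma (β + s + 1) * (Real.exp (-t) * t ^ ((β + 1) - 1)) := by
  simp_rw [besselKernel_eq]
  have h : t ^ ((β + 1) - 1) = t ^ (-s - 1) * t ^ (β + s + 1) := by
    rw [← Real.rpow_add ht]
    ring_nf
  rw [integral_const_mul, Real.integral_rpow_mul_exp_neg_mul_Ioi hs (by positivity),
    one_div_one_div, h]
  ring

theorem integrable_besselKernel {s β : ℝ} (hβ : -1 < β) (hs : 0 ≤ s) :
    Integrable (besselKernel s β)
      ((volume.restrict (Set.Ioi (0 : ℝ))).prod (volume.restrict (Set.Ioi (0 : ℝ)))) := by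
  have hm : Measurable (besselKernel s β) := by unfold besselKernel; fun_prop
  rw [integrable_prod_iff' hm.aestronglyMeasurable]
  have hpos : 0 < β + s + 1 := by linarith
  constructor
  · refine (ae_restrict_iff' measurableSet_Ioi).2 (ae_of_all _ fun t (ht : 0 < t) => ?_)
    refine .of_integral_ne_zero ?_
    rw [integral_besselKernel_fst hpos ht]
    have := Real.Gamma_pos_of_pos hpos
    positivity
  · have hG := (Real.GammaIntegral_convergent (s := β + 1) (by linarith)).const_mul
      (Real.Gamma (β + s + 1))
    refine IntegrableOn.congr_fun hG (fun t (ht : 0 < t) => ?_) measurableSet_Ioi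
    rw [← integral_besselKernel_fst hpos ht]
    refine setIntegral_congr_fun measurableSet_Ioi fun x (hx : 0 < x) => ?_
    rw [Real.norm_of_nonneg]
    simp only [besselKernel]
    positivity

section Moments

variable {ρ : ℝ → ℝ → ℝ} {s β : ℝ}

theorem integral_besselKernel_snd
    (hρ : ∀ s x : ℝ, 0 < x →
      ρ s x = x ^ s * ∫ t in Set.Ioi (0 : ℝ), Real.exp (-t - x / t) * t ^ (-s - 1))
    {x : ℝ} (hx : 0 < x) :
    ∫ t in Set.Ioi (0 : ℝ), besselKernel s β (x, t) = x ^ β * ρ s x := by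
  simp only [besselKernel]
  rw [integral_const_mul, hρ s x hx, Real.rpow_add hx, mul_assoc]

theorem integrableOn_rpow_mul_rho
    (hρ : ∀ s x : ℝ, 0 < x →
      ρ s x = x ^ s * ∫ t in Set.Ioi (0 : ℝ), Real.exp (-t - x / t) * t ^ (-s - 1))
    (hβ : -1 < β) (hs : 0 ≤ s) :
    IntegrableOn (fun x => x ^ β * ρ s x) (Set.Ioi 0) :=
  IntegrableOn.congr_fun (integrable_besselKernel hβ hs).integral_prod_left
    (fun _ hx => integral_besselKernel_snd hρ hx) measurableSet_Ioi

theorem integral_rpow_mul_rho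
    (hρ : ∀ s x : ℝ, 0 < x →
      ρ s x = x ^ s * ∫ t in Set.Ioi (0 : ℝ), Real.exp (-t - x / t) * t ^ (-s - 1))
    (hβ : -1 < β) (hs : 0 ≤ s) :
    ∫ x in Set.Ioi (0 : ℝ), x ^ β * ρ s x = Real.Gamma (β + 1) * Real.Gamma (β + s + 1) := by
  have hpos : 0 < β + s + 1 := by linarith
  calc ∫ x in Set.Ioi (0 : ℝ), x ^ β * ρ s x
      = ∫ x in Set.Ioi (0 : ℝ), ∫ t in Set.Ioi (0 : ℝ), besselKernel s β (x, t) :=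
        setIntegral_congr_fun measurableSet_Ioi fun x hx => (integral_besselKernel_snd hρ hx).symm
    _ = ∫ t in Set.Ioi (0 : ℝ), ∫ x in Set.Ioi (0 : ℝ), besselKernel s β (x, t) :=
        integral_integral_swap (f := fun x t => besselKernel s β (x, t))
          (integrable_besselKernel hβ hs)
    _ = ∫ t in Set.Ioi (0 : ℝ),
          Real.Gamma (β + s + 1) * (Real.exp (-t) * t ^ ((β + 1) - 1)) :=
        setIntegral_congr_fun measurableSet_Ioi fun t ht => integral_besselKernel_fst hpos ht
    _ = Real.Gamma (β + 1) * Real.Gamma (β + s + 1) := by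
        rw [integral_const_mul, ← Real.Gamma_eq_integral (by linarith), mul_comm]

theorem integral_eval_mul_pow_mul_rpow_mul_rho
    (hρ : ∀ s x : ℝ, 0 < x →
      ρ s x = x ^ s * ∫ t in Set.Ioi (0 : ℝ), Real.exp (-t - x / t) * t ^ (-s - 1))
    {α : ℝ} (hα : -1 < α) (hs : 0 ≤ s) (p : Polynomial ℝ) {n : ℕ} (hp : p.natDegree ≤ n) (k : ℕ) :
    ∫ x in Set.Ioi (0 : ℝ), p.eval x * x ^ k * (x ^ α * ρ s x)
      = ∑ j ∈ Finset.range (n + 1), p.coeff j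
        * (Real.Gamma (α + (j + k) + 1) * Real.Gamma (α + (j + k) + s + 1)) := by
  have hβ : ∀ j : ℕ, -1 < α + ((j : ℝ) + k) := fun j => by
    have : (0 : ℝ) ≤ (j : ℝ) + k := by positivity
    linarith
  calc ∫ x in Set.Ioi (0 : ℝ), p.eval x * x ^ k * (x ^ α * ρ s x)
      = ∫ x in Set.Ioi (0 : ℝ), ∑ j ∈ Finset.range (n + 1),
          p.coeff j * (x ^ (α + ((j : ℝ) + k)) * ρ s x) := by
        refine setIntegral_congr_fun measurableSet_Ioi fun x (hx : 0 < x) => ?_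
        rw [eval_eq_sum_range' (Nat.lt_succ_of_le hp), Finset.sum_mul, Finset.sum_mul]
        refine Finset.sum_congr rfl fun j _ => ?_
        rw [Real.rpow_add hx, Real.rpow_add hx, Real.rpow_natCast, Real.rpow_natCast]
        ring
    _ = _ := by
        rw [integral_finsetSum _ fun j _ =>
          (integrableOn_rpow_mul_rho hρ (hβ j) hs).const_mul (p.coeff j)]
        refine Finset.sum_congr rfl fun j _ => ?_
        rw [integral_const_mul, integral_rpow_mul_rho hρ (hβ j) hs]

end Moments

/-- The monic polynomials generated by the four-term recurrence with
`b_n = (n+α+1)(3n+α+2ν) - (α+1)(ν-1)`, `c_n = n(n+α)(n+α+ν)(3n+2α+ν)`,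
`d_n = n(n-1)(n+α)(n+α-1)(n+α+ν)(n+α+ν-1)` are the type II multiple orthogonal
polynomials on the stepline for the Bessel weights `(x^α ρ_ν, x^α ρ_{ν+1})` on `(0,∞)`. -/
theorem bessel_K_stepline_orthogonality
    (ν α : ℝ) (hν : 0 ≤ ν) (hα : -1 < α)
    (ρ : ℝ → ℝ → ℝ)
    (hρ : ∀ s x : ℝ, 0 < x →
      ρ s x = x ^ s * ∫ t in Set.Ioi (0 : ℝ), Real.exp (-t - x / t) * t ^ (-s - 1))
    (P : ℕ → Polynomial ℝ) (hP0 : P 0 = 1)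
    (hrec : ∀ n : ℕ,
      P (n + 1) = (X - C (((n : ℝ) + α + 1) * (3 * (n : ℝ) + α + 2 * ν)
          - (α + 1) * (ν - 1))) * P n
        - C ((n : ℝ) * ((n : ℝ) + α) * ((n : ℝ) + α + ν) * (3 * (n : ℝ) + 2 * α + ν))
            * P (n - 1)
        - C ((n : ℝ) * ((n : ℝ) - 1) * ((n : ℝ) + α) * ((n : ℝ) + α - 1)
            * ((n : ℝ) + α + ν) * ((n : ℝ) + α + ν - 1)) * P (n - 2)) :
    ∀ n : ℕ,
      (∀ k < n, ∫ x in Set.Ioi (0 : ℝ), (P (2 * n)).eval x * x ^ k * (x ^ α * ρ ν x) = 0) ∧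
      (∀ k < n, ∫ x in Set.Ioi (0 : ℝ),
        (P (2 * n)).eval x * x ^ k * (x ^ α * ρ (ν + 1) x) = 0) ∧
      (∀ k ≤ n, ∫ x in Set.Ioi (0 : ℝ),
        (P (2 * n + 1)).eval x * x ^ k * (x ^ α * ρ ν x) = 0) ∧
      (∀ k < n, ∫ x in Set.Ioi (0 : ℝ),
        (P (2 * n + 1)).eval x * x ^ k * (x ^ α * ρ (ν + 1) x) = 0) := by
  have ha : 0 < α + 1 := by linarith
  have hb : 0 < α + ν + 1 := by linarith
  have hcoeff := coeff_eq_hypergeometricCoeff hν hα P hP0 hrec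
  have hdeg : ∀ n, (P n).natDegree ≤ n := fun n => by
    refine natDegree_le_iff_coeff_eq_zero.2 fun j hj => ?_
    simp [hcoeff, hypergeometricCoeff, Nat.choose_eq_zero_of_lt hj]
  have key : ∀ n k l : ℕ, k + (k + l) < n → ∫ x in Set.Ioi (0 : ℝ),
      (P n).eval x * x ^ k * (x ^ α * ρ (ν + l) x) = 0 := fun n k l h => by
    rw [integral_eval_mul_pow_mul_rpow_mul_rho hρ hα (by positivity) (P n) (hdeg n) k,
      ← sum_hypergeometricCoeff_mul_Gamma_eq_zero ha hb h]
    refine Finset.sum_congr rfl fun j _ => ?_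
    rw [hcoeff]
    push_cast
    ring_nf
  have key₀ := fun n k => key n k 0
  have key₁ := fun n k => key n k 1
  simp only [Nat.cast_zero, Nat.cast_one, add_zero] at key₀ key₁
  exact fun n => ⟨fun k hk => key₀ _ _ (by omega), fun k hk => key₁ _ _ (by omega),
    fun k hk => key₀ _ _ (by omega), fun k hk => key₁ _ _ (by omega)⟩
end
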